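/- Let E be a Riesz space with point separating order dual, write Z(E^~) = C(K) with K hyperstonian, and let p ∈ C(K)'' be the band projection of C(K)' onto the band C(K)_n' = C(K)_* of order continuous functionals. Then p ≤ π (where π is the idempotent with Z(E^{~~}) = π·C(K)'' and Ker(m) = (1−π)·C(K)''), and the action of p on the order bidual satisfies p∘E^{~~} = (E^~)_n^~: an order bounded functional x'' on E^~ satisfies p∘x'' = x'' exactly when x'' is order continuous, and p∘x'' is always order continuous. -/

import Mathlib

noncomputable section

open Set

/-- A map between preordered sets is *order bounded* if it maps order intervals into
order intervals. -/
def IsOrdBdd {E F : Type*} [Preorder E] [Preorder F] (f : E → F) : Prop :=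
  ∀ a b : E, ∃ c d : F, ∀ x : E, a ≤ x → x ≤ b → c ≤ f x ∧ f x ≤ d

/-- A map of a Riesz space is *band preserving* if it preserves disjointness. -/
def IsBandPres {E : Type*} [Lattice E] [AddCommGroup E] (T : E → E) : Prop :=
  ∀ x y : E, |x| ⊓ |y| = 0 → |T x| ⊓ |y| = 0

/-- An *orthomorphism*: an order bounded, band preserving linear map. -/
def IsOrtho {E : Type*} [Lattice E] [AddCommGroup E] [Module ℝ E] (T : E → E) : Prop :=
  IsLinearMap ℝ T ∧ IsOrdBdd T ∧ IsBandPres T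

/-- A member of the *ideal center* `Z(E)`: an orthomorphism dominated by a multiple of the
identity. -/
def IsCentral {E : Type*} [Lattice E] [AddCommGroup E] [Module ℝ E] (T : E → E) : Prop :=
  IsOrtho T ∧ ∃ c : ℝ, ∀ x : E, 0 ≤ x → -(c • x) ≤ T x ∧ T x ≤ c • x

/-- Order continuity of a real functional: it converges to `0` along every downward
directed system with infimum `0`. -/
def IsOrderContinuousFun {X : Type*} [Lattice X] [AddCommGroup X] (φ : X → ℝ) : Prop :=
  ∀ s : Set X, s.Nonempty → DirectedOn (· ≥ ·) s → IsGLB s 0 →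
    ∀ ε : ℝ, 0 < ε → ∃ x ∈ s, ∀ y ∈ s, y ≤ x → |φ y| < ε

/-- `p` realizes the Riesz space `D` as the order dual `E^∼` of `E`. -/
structure IsOrderDual (E D : Type*) [Lattice E] [AddCommGroup E] [Module ℝ E]
    [Lattice D] [AddCommGroup D] [Module ℝ D] (p : D → E → ℝ) : Prop where
  lin_fun : ∀ f : D, IsLinearMap ℝ (p f)
  lin_vec : ∀ x : E, IsLinearMap ℝ fun f => p f x
  bdd : ∀ f : D, IsOrdBdd (p f)
  inj : ∀ f g : D, (∀ x, p f x = p g x) → f = g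
  surj : ∀ φ : E → ℝ, IsLinearMap ℝ φ → IsOrdBdd φ → ∃ f : D, ∀ x, p f x = φ x
  le_iff : ∀ f g : D, f ≤ g ↔ ∀ x : E, 0 ≤ x → p f x ≤ p g x

/-- `p` realizes the Riesz space `B` as the order continuous order dual `(X^∼)ₙ` of `X`
(used for `X = A^∼`, giving `B = (A^∼)ₙ^∼`). -/
structure IsOrderContinuousDual (X B : Type*) [Lattice X] [AddCommGroup X] [Module ℝ X]
    [Lattice B] [AddCommGroup B] [Module ℝ B] (p : B → X → ℝ) : Prop where
  lin_fun : ∀ F : B, IsLinearMap ℝ (p F)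
  lin_vec : ∀ f : X, IsLinearMap ℝ fun F => p F f
  bdd : ∀ F : B, IsOrdBdd (p F)
  cont : ∀ F : B, IsOrderContinuousFun (p F)
  inj : ∀ F G : B, (∀ f, p F f = p G f) → F = G
  surj : ∀ φ : X → ℝ, IsLinearMap ℝ φ → IsOrdBdd φ → IsOrderContinuousFun φ →
    ∃ F : B, ∀ f, p F f = φ f
  le_iff : ∀ F G : B, F ≤ G ↔ ∀ f : X, 0 ≤ f → p F f ≤ p G f

/-- `ρ` realizes the lattice-ordered algebra `O` as the `f`-algebra `Orth(E)` of all
orthomorphisms of `E`. -/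
structure IsOrthAlg (E O : Type*) [Lattice E] [AddCommGroup E] [Module ℝ E]
    [Lattice O] [Ring O] [Module ℝ O] (ρ : O → E → E) : Prop where
  ortho : ∀ a : O, IsOrtho (ρ a)
  lin_vec : ∀ x : E, IsLinearMap ℝ fun a => ρ a x
  map_one : ∀ x : E, ρ 1 x = x
  map_mul : ∀ (a b : O) (x : E), ρ (a * b) x = ρ a (ρ b x)
  inj : ∀ a b : O, (∀ x, ρ a x = ρ b x) → a = b
  surj : ∀ T : E → E, IsOrtho T → ∃ a : O, ∀ x, ρ a x = T x
  le_iff : ∀ a b : O, a ≤ b ↔ ∀ x : E, 0 ≤ x → ρ a x ≤ ρ b x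

/-- `ρ` realizes the normed lattice-ordered algebra `Z` as the ideal center `Z(E)` of `E`,
an AM-space whose norm is the order unit norm (the order/algebra unit being `id`). -/
structure IsCenterOf (E Z : Type*) [Lattice E] [AddCommGroup E] [Module ℝ E]
    [Lattice Z] [NormedRing Z] [NormedAlgebra ℝ Z] (ρ : Z → E → E) : Prop where
  central : ∀ a : Z, IsCentral (ρ a)
  lin_vec : ∀ x : E, IsLinearMap ℝ fun a => ρ a x
  map_one : ∀ x : E, ρ 1 x = x
  map_mul : ∀ (a b : Z) (x : E), ρ (a * b) x = ρ a (ρ b x)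
  inj : ∀ a b : Z, (∀ x, ρ a x = ρ b x) → a = b
  surj : ∀ T : E → E, IsCentral T → ∃ a : Z, ∀ x, ρ a x = T x
  le_iff : ∀ a b : Z, a ≤ b ↔ ∀ x : E, 0 ≤ x → ρ a x ≤ ρ b x
  norm_le_iff : ∀ (a : Z) (c : ℝ), 0 ≤ c →
    (‖a‖ ≤ c ↔ ∀ x : E, 0 ≤ x → -(c • x) ≤ ρ a x ∧ ρ a x ≤ c • x)

/-- The pairing `p : D → E → ℝ` separates the points of `E`. -/
def SepPoints {E D : Type*} [Zero E] (p : D → E → ℝ) : Prop :=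
  ∀ x : E, (∀ f : D, p f x = 0) → x = 0

/-- `y` belongs to the `σ(E,D)`-closure of `s ⊆ E`, for the pairing `p : D → E → ℝ`. -/
def InWeakClosure {E D : Type*} (p : D → E → ℝ) (s : Set E) (y : E) : Prop :=
  ∀ (fs : Finset D) (ε : ℝ), 0 < ε → ∃ z ∈ s, ∀ f ∈ fs, |p f z - p f y| < ε

/-- `E` has a *topologically full center*: for each `x ∈ E₊` the `σ(E,E^∼)`-closure of
`Z(E)x` contains the order ideal generated by `x`.  Here `p : D → E → ℝ` is the duality
with `E^∼` and `ρ : Z → E → E` is the action of the ideal center. -/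
def TopFullCenter {E D Z : Type*} [Lattice E] [AddCommGroup E] [Module ℝ E]
    (p : D → E → ℝ) (ρ : Z → E → E) : Prop :=
  ∀ x : E, 0 ≤ x → ∀ y : E, (∃ c : ℝ, 0 ≤ c ∧ |y| ≤ c • x) →
    InWeakClosure p {z | ∃ T : Z, ρ T x = z} y

/-- `FG` is the Arens product `F ⬝ G` in the order bidual `B` of the algebra `A`:
`(F⬝G)(f) = F(G⬝f)`, `(G⬝f)(a) = G(f⬝a)`, `(f⬝a)(b) = f(ab)`; `pA : DA → A → ℝ` is the
duality of `A` with `A^∼` and `pB : B → DA → ℝ` that of `(A^∼)ₙ^∼` with `A^∼`. -/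
def IsArensProduct {A DA B : Type*} [Mul A] (pA : DA → A → ℝ) (pB : B → DA → ℝ)
    (F G FG : B) : Prop :=
  ∀ f Gf : DA,
    (∀ (a : A) (fa : DA), (∀ b : A, pA fa b = pA f (a * b)) → pA Gf a = pB G fa) →
    pB FG f = pB F Gf

/-- The ring structure of `B` is the Arens multiplication inherited from `A`, with unit the
canonical image of `1 ∈ A`. -/
structure IsArensAlgebra {A DA B : Type*} [Monoid A] [Ring B]
    (pA : DA → A → ℝ) (pB : B → DA → ℝ) : Prop where
  mul_def : ∀ F G : B, IsArensProduct pA pB F G (F * G)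
  one_def : ∀ f : DA, pB 1 f = pA f 1

section NormedArens

variable (Z : Type*) [NormedRing Z] [NormedAlgebra ℝ Z]

/-- First step of the Arens construction: `f ⬝ a` for `f ∈ Z'`, `a ∈ Z`:
`(f⬝a)(b) = f(ab)`. -/
def arensDot (f : Z →L[ℝ] ℝ) (a : Z) : Z →L[ℝ] ℝ :=
  f.comp (ContinuousLinearMap.mul ℝ Z a)

/-- `a ↦ f ⬝ a` as a continuous linear map. -/
def arensDotL (f : Z →L[ℝ] ℝ) : Z →L[ℝ] Z →L[ℝ] ℝ :=
  (ContinuousLinearMap.compL ℝ Z Z ℝ f).comp (ContinuousLinearMap.mul ℝ Z)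

/-- Second step of the Arens construction: `F ⬝ f` for `F ∈ Z''`, `f ∈ Z'`:
`(F⬝f)(a) = F(f⬝a)`. -/
def arensFDot (F : (Z →L[ℝ] ℝ) →L[ℝ] ℝ) (f : Z →L[ℝ] ℝ) : Z →L[ℝ] ℝ :=
  F.comp (arensDotL Z f)

/-- `f ↦ f ⬝ ·` as a continuous linear map. -/
def arensDotLL : (Z →L[ℝ] ℝ) →L[ℝ] Z →L[ℝ] Z →L[ℝ] ℝ :=
  ((ContinuousLinearMap.compL ℝ Z (Z →L[ℝ] Z) (Z →L[ℝ] ℝ)).flip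
      (ContinuousLinearMap.mul ℝ Z)).comp (ContinuousLinearMap.compL ℝ Z Z ℝ)

/-- `f ↦ F ⬝ f` as a continuous linear map. -/
def arensFDotL (F : (Z →L[ℝ] ℝ) →L[ℝ] ℝ) : (Z →L[ℝ] ℝ) →L[ℝ] Z →L[ℝ] ℝ :=
  (ContinuousLinearMap.compL ℝ Z (Z →L[ℝ] ℝ) ℝ F).comp (arensDotLL Z)

/-- The *Arens product* on the norm bidual `Z''`: `(F⬝G)(f) = F(G⬝f)`. -/
def arensMul (F G : (Z →L[ℝ] ℝ) →L[ℝ] ℝ) : (Z →L[ℝ] ℝ) →L[ℝ] ℝ :=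
  F.comp (arensFDotL Z G)

/-- The canonical image of `1 ∈ Z` in the bidual `Z''`; it is the unit for the Arens
product. -/
def arensOne : (Z →L[ℝ] ℝ) →L[ℝ] ℝ := ContinuousLinearMap.apply ℝ ℝ (1 : Z)

end NormedArens

section DualOrder

variable {Z : Type*} [Lattice Z] [NormedRing Z] [NormedAlgebra ℝ Z]

/-- Positivity of a functional in `Z'`. -/
def dualNonneg (μ : Z →L[ℝ] ℝ) : Prop := ∀ a : Z, 0 ≤ a → 0 ≤ μ a

/-- The canonical order of the bidual `Z''`. -/
def bidualLe (F G : (Z →L[ℝ] ℝ) →L[ℝ] ℝ) : Prop :=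
  ∀ μ : Z →L[ℝ] ℝ, dualNonneg μ → F μ ≤ G μ

/-- `H = F ⊔ G` in the bidual `Z''`. -/
def IsBidualSup (F G H : (Z →L[ℝ] ℝ) →L[ℝ] ℝ) : Prop :=
  bidualLe F H ∧ bidualLe G H ∧
    ∀ K : (Z →L[ℝ] ℝ) →L[ℝ] ℝ, bidualLe F K → bidualLe G K → bidualLe H K

/-- `s ⊆ Z''` is downward directed with infimum `0`. -/
def BidualDownTo0 (s : Set ((Z →L[ℝ] ℝ) →L[ℝ] ℝ)) : Prop :=
  s.Nonempty ∧ (∀ F ∈ s, ∀ G ∈ s, ∃ H ∈ s, bidualLe H F ∧ bidualLe H G) ∧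
    (∀ F ∈ s, bidualLe 0 F) ∧ ∀ K, (∀ F ∈ s, bidualLe K F) → bidualLe K 0

/-- The Riesz–Kantorovich formula for `|μ|(a)`, `μ ∈ Z'`, `a ∈ Z₊`. -/
def dualAbs (μ : Z →L[ℝ] ℝ) (a : Z) : ℝ := sSup ((fun b => μ b) '' {b : Z | |b| ≤ a})

/-- Disjointness `|μ| ⊓ |ν| = 0` in `Z'`. -/
def DualDisjoint (μ ν : Z →L[ℝ] ℝ) : Prop :=
  ∀ a : Z, 0 ≤ a → ∀ ε : ℝ, 0 < ε →
    ∃ b c : Z, 0 ≤ b ∧ 0 ≤ c ∧ b + c = a ∧ dualAbs μ b + dualAbs ν c < ε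

/-- The Riesz–Kantorovich formula for `|F|(μ)`, `F ∈ Z''`, `μ ∈ Z'₊`. -/
def bidualAbs (F : (Z →L[ℝ] ℝ) →L[ℝ] ℝ) (μ : Z →L[ℝ] ℝ) : ℝ :=
  sSup ((fun ν => F ν) '' {ν : Z →L[ℝ] ℝ | ∀ a : Z, 0 ≤ a → dualAbs ν a ≤ μ a})

/-- Disjointness `|F| ⊓ |G| = 0` in `Z''`. -/
def BidualDisjoint (F G : (Z →L[ℝ] ℝ) →L[ℝ] ℝ) : Prop :=
  ∀ μ : Z →L[ℝ] ℝ, dualNonneg μ → ∀ ε : ℝ, 0 < ε →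
    ∃ μ₁ μ₂ : Z →L[ℝ] ℝ, dualNonneg μ₁ ∧ dualNonneg μ₂ ∧ μ₁ + μ₂ = μ ∧
      bidualAbs F μ₁ + bidualAbs G μ₂ < ε

end DualOrder

/-- A member of the ideal center `Z(J)` of an order ideal `J` of a Riesz space, encoded as a
map defined on the ambient space whose restriction to `J` is the actual operator. -/
def IsCentralOn {D : Type*} [Lattice D] [AddCommGroup D] [Module ℝ D]
    (J : Set D) (S : D → D) : Prop :=
  (∀ f ∈ J, S f ∈ J) ∧ (∀ f ∈ J, ∀ g ∈ J, S (f + g) = S f + S g) ∧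
    (∀ (c : ℝ), ∀ f ∈ J, S (c • f) = c • S f) ∧
    ∃ c : ℝ, ∀ f ∈ J, 0 ≤ f → -(c • f) ≤ S f ∧ S f ≤ c • f

end

set_option linter.unusedSectionVars false

section RieszSpace

variable {X Y : Type*}
  [Lattice X] [AddCommGroup X] [IsOrderedAddMonoid X] [Module ℝ X] [PosSMulMono ℝ X]

/-- A map that is additive and positively homogeneous on the positive cone of a Riesz space
extends to a linear map. -/
theorem exists_linearMap_eq_of_nonneg [AddCommGroup Y] [Module ℝ Y] (T : X → Y)
    (hadd : ∀ x y, 0 ≤ x → 0 ≤ y → T (x + y) = T x + T y)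
    (hsmul : ∀ (c : ℝ) (x : X), 0 ≤ c → 0 ≤ x → T (c • x) = c • T x) :
    ∃ L : X →ₗ[ℝ] Y, ∀ x, 0 ≤ x → L x = T x := by
  have key : ∀ x a b : X, 0 ≤ a → 0 ≤ b → x = a - b → T x⁺ - T x⁻ = T a - T b := by
    intro x a b ha hb h
    have h1 : x⁺ + b = a + x⁻ := by
      have := posPart_sub_negPart x
      rw [h] at this ⊢
      rw [← sub_eq_sub_iff_add_eq_add, this]
    have h2 := congrArg T h1
    rw [hadd _ _ (posPart_nonneg x) hb, hadd _ _ ha (negPart_nonneg x)] at h2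
    rw [sub_eq_sub_iff_add_eq_add, h2]
  have h0 : T 0 = 0 := by simpa using hsmul 0 0 le_rfl le_rfl
  have smul_nonneg' : ∀ (c : ℝ) (x : X), 0 ≤ c →
      T (c • x)⁺ - T (c • x)⁻ = c • (T x⁺ - T x⁻) := by
    intro c x hc
    rw [key (c • x) (c • x⁺) (c • x⁻) (smul_nonneg hc (posPart_nonneg x))
      (smul_nonneg hc (negPart_nonneg x)) (by rw [← smul_sub, posPart_sub_negPart]),
      hsmul _ _ hc (posPart_nonneg x), hsmul _ _ hc (negPart_nonneg x), smul_sub]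
  refine ⟨{ toFun := fun x => T x⁺ - T x⁻, map_add' := ?_, map_smul' := ?_ }, ?_⟩
  · intro x y
    rw [key (x + y) (x⁺ + y⁺) (x⁻ + y⁻) (add_nonneg (posPart_nonneg x) (posPart_nonneg y))
      (add_nonneg (negPart_nonneg x) (negPart_nonneg y)) ?_,
      hadd _ _ (posPart_nonneg x) (posPart_nonneg y),
      hadd _ _ (negPart_nonneg x) (negPart_nonneg y)]
    · abel
    · nth_rewrite 1 [← posPart_sub_negPart x, ← posPart_sub_negPart y]
      abel
  · intro c x
    rcases le_total 0 c with hc | hc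
    · exact smul_nonneg' c x hc
    · have h1 := smul_nonneg' (-c) x (neg_nonneg.2 hc)
      have h2 := key (c • x) ((-c) • x)⁻ ((-c) • x)⁺ (negPart_nonneg _) (posPart_nonneg _)
        (by rw [← neg_sub, posPart_sub_negPart, neg_smul, neg_neg])
      simp only [RingHom.id_apply]
      rw [h2, ← neg_sub, h1, neg_smul, neg_neg]
  · intro x hx
    change T x⁺ - T x⁻ = T x
    rw [key x x 0 hx le_rfl (by simp), h0, sub_zero]

variable [Lattice Y] [AddCommGroup Y] [IsOrderedAddMonoid Y] [Module ℝ Y] [PosSMulMono ℝ Y]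

theorem isLUB_range_add_of_directed {ι : Type*} {u v : ι → Y} {a b : Y}
    (hdir : ∀ i j, ∃ k, u i ≤ u k ∧ v j ≤ v k)
    (ha : IsLUB (Set.range u) a) (hb : IsLUB (Set.range v) b) :
    IsLUB (Set.range fun i => u i + v i) (a + b) := by
  constructor
  · rintro _ ⟨i, rfl⟩
    exact add_le_add (ha.1 ⟨i, rfl⟩) (hb.1 ⟨i, rfl⟩)
  · intro c hc
    have h1 : ∀ i, u i + b ≤ c := by
      intro i
      rw [← le_sub_iff_add_le']
      refine hb.2 ?_
      rintro _ ⟨j, rfl⟩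
      obtain ⟨k, hik, hjk⟩ := hdir i j
      rw [le_sub_iff_add_le']
      exact (add_le_add hik hjk).trans (hc ⟨k, rfl⟩)
    rw [← le_sub_iff_add_le]
    refine ha.2 ?_
    rintro _ ⟨i, rfl⟩
    rw [le_sub_iff_add_le]
    exact h1 i

theorem isLUB_range_smul {ι : Type*} {u : ι → Y} {a : Y} {c : ℝ} (hc : 0 < c)
    (ha : IsLUB (Set.range u) a) : IsLUB (Set.range fun i => c • u i) (c • a) := by
  constructor
  · rintro _ ⟨i, rfl⟩
    exact smul_le_smul_of_nonneg_left (ha.1 ⟨i, rfl⟩) hc.le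
  · intro d hd
    have h1 : a ≤ c⁻¹ • d := by
      refine ha.2 ?_
      rintro _ ⟨i, rfl⟩
      have := smul_le_smul_of_nonneg_left (hd ⟨i, rfl⟩) (inv_nonneg.2 hc.le)
      simpa [smul_smul, inv_mul_cancel₀ hc.ne'] using this
    have := smul_le_smul_of_nonneg_left h1 hc.le
    simpa [smul_smul, mul_inv_cancel₀ hc.ne'] using this

/-- The pointwise supremum on the positive cone of a directed family of linear maps extends
to a linear map. -/
theorem exists_linearMap_isLUB {ι : Type*} [Nonempty ι] (L : ι → X → Y)
    (hL : ∀ i, IsLinearMap ℝ (L i))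
    (hdir : ∀ i j, ∃ k, ∀ x, 0 ≤ x → L i x ≤ L k x ∧ L j x ≤ L k x)
    (hex : ∀ x, 0 ≤ x → ∃ y, IsLUB (Set.range fun i => L i x) y) :
    ∃ M : X →ₗ[ℝ] Y, ∀ x, 0 ≤ x → IsLUB (Set.range fun i => L i x) (M x) := by
  classical
  choose! T hT using hex
  have hadd : ∀ x y, 0 ≤ x → 0 ≤ y → T (x + y) = T x + T y := by
    intro x y hx hy
    refine (hT _ (add_nonneg hx hy)).unique ?_
    simp only [(hL _).map_add]
    refine isLUB_range_add_of_directed (fun i j => ?_) (hT x hx) (hT y hy)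
    obtain ⟨k, hk⟩ := hdir i j
    exact ⟨k, (hk x hx).1, (hk y hy).2⟩
  have hsmul : ∀ (c : ℝ) (x : X), 0 ≤ c → 0 ≤ x → T (c • x) = c • T x := by
    intro c x hc hx
    refine (hT _ (smul_nonneg hc hx)).unique ?_
    simp only [(hL _).map_smul]
    rcases hc.eq_or_lt with rfl | hc
    · simp
    · exact isLUB_range_smul hc (hT x hx)
  obtain ⟨M, hM⟩ := exists_linearMap_eq_of_nonneg T hadd hsmul
  exact ⟨M, fun x hx => hM x hx ▸ hT x hx⟩

theorem LinearMap.abs_le_abs_of_nonneg_of_le {L : X →ₗ[ℝ] X}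
    (hL : ∀ x, 0 ≤ x → 0 ≤ L x ∧ L x ≤ x) (x : X) : |L x| ≤ |x| := by
  have h1 : L x = L x⁺ - L x⁻ := by rw [← map_sub, posPart_sub_negPart]
  have h2 : |x| = x⁺ + x⁻ := (posPart_add_negPart x).symm
  have hp := hL _ (posPart_nonneg x)
  have hn := hL _ (negPart_nonneg x)
  rw [h1, h2, abs_le']
  constructor
  · exact (sub_le_self _ hn.1).trans (hp.2.trans (le_add_of_nonneg_right (negPart_nonneg x)))
  · rw [neg_sub]
    exact (sub_le_self _ hp.1).trans (hn.2.trans (le_add_of_nonneg_left (posPart_nonneg x)))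

theorem LinearMap.mono_of_nonneg {L : X →ₗ[ℝ] Y} (hL : ∀ x, 0 ≤ x → 0 ≤ L x) : Monotone L := by
  intro a b hab
  have := hL _ (sub_nonneg.2 hab)
  rwa [map_sub, sub_nonneg] at this

theorem LinearMap.isOrdBdd_of_nonneg {L : X →ₗ[ℝ] Y} (hL : ∀ x, 0 ≤ x → 0 ≤ L x) :
    IsOrdBdd L := fun a b =>
  ⟨L a, L b, fun _ h1 h2 => ⟨mono_of_nonneg hL h1, mono_of_nonneg hL h2⟩⟩

theorem isCentral_of_nonneg_of_le {L : X →ₗ[ℝ] X}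
    (hL : ∀ x, 0 ≤ x → 0 ≤ L x ∧ L x ≤ x) : IsCentral (L : X → X) := by
  refine ⟨⟨L.isLinear, LinearMap.isOrdBdd_of_nonneg fun x hx => (hL x hx).1, ?_⟩, 1, ?_⟩
  · intro x y hxy
    refine le_antisymm ?_ (le_inf (abs_nonneg _) (abs_nonneg _))
    exact (inf_le_inf_right _ (LinearMap.abs_le_abs_of_nonneg_of_le hL x)).trans hxy.le
  · intro x hx
    rw [one_smul]
    exact ⟨(neg_nonpos.2 hx).trans (hL x hx).1, (hL x hx).2⟩

theorem IsOrderContinuousFun.sub {φ ψ : X → ℝ} (hφ : IsOrderContinuousFun φ)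
    (hψ : IsOrderContinuousFun ψ) : IsOrderContinuousFun fun x => φ x - ψ x := by
  intro s hs hdir hglb ε hε
  obtain ⟨a, ha, ha'⟩ := hφ s hs hdir hglb (ε / 2) (half_pos hε)
  obtain ⟨b, hb, hb'⟩ := hψ s hs hdir hglb (ε / 2) (half_pos hε)
  obtain ⟨c, hc, hca, hcb⟩ := hdir a ha b hb
  refine ⟨c, hc, fun y hy hyc => ?_⟩
  have h1 := ha' y hy (hyc.trans hca)
  have h2 := hb' y hy (hyc.trans hcb)
  rw [abs_lt] at *
  constructor <;> linarith

theorem IsOrderContinuousFun.of_nonneg_of_le {φ ψ : X → ℝ} (hψ : IsOrderContinuousFun ψ)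
    (h0 : ∀ x, 0 ≤ x → 0 ≤ φ x) (hle : ∀ x, 0 ≤ x → φ x ≤ ψ x) : IsOrderContinuousFun φ := by
  intro s hs hdir hglb ε hε
  obtain ⟨a, ha, ha'⟩ := hψ s hs hdir hglb ε hε
  refine ⟨a, ha, fun y hy hya => ?_⟩
  have hy0 : 0 ≤ y := hglb.1 hy
  rw [abs_of_nonneg (h0 y hy0)]
  exact (hle y hy0).trans_lt ((le_abs_self _).trans_lt (ha' y hy hya))

end RieszSpace

section OrderDual

variable {E D : Type*}
  [Lattice E] [AddCommGroup E] [IsOrderedAddMonoid E] [Module ℝ E] [PosSMulMono ℝ E]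
  [Lattice D] [AddCommGroup D] [IsOrderedAddMonoid D] [Module ℝ D] [PosSMulMono ℝ D]
  {pE : D → E → ℝ}

theorem IsOrderDual.map_zero (hD : IsOrderDual E D pE) (x : E) : pE 0 x = 0 :=
  (hD.lin_vec x).map_zero

theorem IsOrderDual.nonneg (hD : IsOrderDual E D pE) {f : D} (hf : 0 ≤ f) {x : E}
    (hx : 0 ≤ x) : 0 ≤ pE f x := by
  simpa [hD.map_zero] using (hD.le_iff 0 f).1 hf x hx

/-- Bounded directed sets in an order dual have pointwise suprema. -/
theorem IsOrderDual.exists_isLUB (hD : IsOrderDual E D pE) {ι : Type*} [Nonempty ι]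
    (u : ι → D) (hdir : ∀ i j, ∃ k, u i ≤ u k ∧ u j ≤ u k) (g : D) (hg : ∀ i, u i ≤ g) :
    ∃ f, IsLUB (Set.range u) f ∧
      ∀ x, 0 ≤ x → IsLUB (Set.range fun i => pE (u i) x) (pE f x) := by
  obtain ⟨M, hM⟩ := exists_linearMap_isLUB (fun i => pE (u i)) (fun i => hD.lin_fun _)
    (fun i j => by
      obtain ⟨k, h1, h2⟩ := hdir i j
      exact ⟨k, fun x hx => ⟨(hD.le_iff _ _).1 h1 x hx, (hD.le_iff _ _).1 h2 x hx⟩⟩)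
    (fun x hx => ⟨_, isLUB_ciSup ⟨pE g x, by
      rintro _ ⟨i, rfl⟩
      exact (hD.le_iff _ _).1 (hg i) x hx⟩⟩)
  obtain ⟨i₀⟩ := ‹Nonempty ι›
  have hpos : ∀ x, 0 ≤ x → 0 ≤ (M - (hD.lin_fun (u i₀)).mk') x := by
    intro x hx
    simpa using (hM x hx).1 ⟨i₀, rfl⟩
  have hbdd : IsOrdBdd M := by
    intro a b
    obtain ⟨c, d, h⟩ := hD.bdd (u i₀) a b
    obtain ⟨c', d', h'⟩ := LinearMap.isOrdBdd_of_nonneg hpos a b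
    refine ⟨c + c', d + d', fun x hax hxb => ?_⟩
    have h1 := h x hax hxb
    have h2 := h' x hax hxb
    simp only [LinearMap.sub_apply, IsLinearMap.mk'_apply] at h2
    constructor <;> linarith
  obtain ⟨f, hf⟩ := hD.surj M M.isLinear hbdd
  have hf' : ∀ x, 0 ≤ x → IsLUB (Set.range fun i => pE (u i) x) (pE f x) := by
    intro x hx
    rw [hf]
    exact hM x hx
  refine ⟨f, ⟨?_, fun h hh => ?_⟩, hf'⟩
  · rintro _ ⟨i, rfl⟩
    exact (hD.le_iff _ _).2 fun x hx => (hf' x hx).1 ⟨i, rfl⟩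
  · refine (hD.le_iff _ _).2 fun x hx => (hf' x hx).2 ?_
    rintro _ ⟨i, rfl⟩
    exact (hD.le_iff _ _).1 (hh ⟨i, rfl⟩) x hx

theorem IsOrderDual.nonpos_of_forall_le_smul (hD : IsOrderDual E D pE) {u f : D}
    (h : ∀ ε : ℝ, 0 < ε → u ≤ ε • f) : u ≤ 0 := by
  refine (hD.le_iff _ _).2 fun x hx => ?_
  rw [hD.map_zero]
  have h1 : ∀ ε : ℝ, 0 < ε → pE u x ≤ ε * pE f x := fun ε hε => by
    have := (hD.le_iff _ _).1 (h ε hε) x hx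
    rwa [(hD.lin_vec x).map_smul, smul_eq_mul] at this
  by_contra! hpos
  have h2 := h1 1 one_pos
  have h3 := h1 (pE u x / (2 * pE f x)) (by apply div_pos <;> linarith)
  have h4 : pE f x ≠ 0 := by linarith
  have h5 : pE u x / (2 * pE f x) * pE f x = pE u x / 2 := by field_simp
  linarith

theorem IsOrderDual.isOrderContinuousFun_eval (hD : IsOrderDual E D pE) {x : E} (hx : 0 ≤ x) :
    IsOrderContinuousFun fun f => pE f x := by
  intro s hs hdir hglb ε hε
  have : Nonempty s := hs.to_subtype
  obtain ⟨F, hF, hF'⟩ := hD.exists_isLUB (fun f : s => -(f : D))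
    (fun i j => by
      obtain ⟨k, hk, h1, h2⟩ := hdir i i.2 j j.2
      exact ⟨⟨k, hk⟩, neg_le_neg h1, neg_le_neg h2⟩)
    0 (fun i => neg_nonpos.2 (hglb.1 i.2))
  have hF0 : 0 ≤ F := by
    have : -F ≤ 0 := hglb.2 fun f hf => by
      have := hF.1 ⟨⟨f, hf⟩, rfl⟩
      exact neg_le.1 this
    exact neg_nonpos.1 this
  have h1 : -ε < pE F x := (neg_lt_zero.2 hε).trans_le (hD.nonneg hF0 hx)
  obtain ⟨_, ⟨⟨f, hf⟩, rfl⟩, h2, -⟩ := (hF' x hx).exists_between h1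
  refine ⟨f, hf, fun y hy hyf => ?_⟩
  have h3 : pE (-f) x = -pE f x := (hD.lin_vec x).map_neg f
  have h4 := (hD.le_iff _ _).1 hyf x hx
  have h5 := hD.nonneg (hglb.1 hy) hx
  simp only at h2
  rw [abs_of_nonneg h5]
  linarith

end OrderDual

/-- `Θ` identifies the unital `f`-algebra `C(K)` with the ideal center of `D`. -/
structure IsCenterRep {D K : Type*} [Lattice D] [AddCommGroup D] [Module ℝ D]
    [TopologicalSpace K] (Θ : C(K, ℝ) → D → D) : Prop where
  map_add : ∀ h h' : C(K, ℝ), Θ (h + h') = Θ h + Θ h'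
  map_smul : ∀ (c : ℝ) (h : C(K, ℝ)), Θ (c • h) = c • Θ h
  map_mul : ∀ (h h' : C(K, ℝ)) (f : D), Θ (h * h') f = Θ h (Θ h' f)
  map_one : ∀ f : D, Θ 1 f = f
  inj : Function.Injective Θ
  central : ∀ h : C(K, ℝ), IsCentral (Θ h)
  surj : ∀ S : D → D, IsCentral S → ∃ h : C(K, ℝ), Θ h = S
  map_sup : ∀ (h h' : C(K, ℝ)) (f : D), 0 ≤ f → Θ (h ⊔ h') f = Θ h f ⊔ Θ h' f

namespace IsCenterRep

variable {E D K : Type*}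
  [Lattice E] [AddCommGroup E] [IsOrderedAddMonoid E] [Module ℝ E] [PosSMulMono ℝ E]
  [Lattice D] [AddCommGroup D] [IsOrderedAddMonoid D] [Module ℝ D] [PosSMulMono ℝ D]
  [TopologicalSpace K] {pE : D → E → ℝ} {Θ : C(K, ℝ) → D → D}

theorem isLinearMap (hΘ : IsCenterRep Θ) (h : C(K, ℝ)) : IsLinearMap ℝ (Θ h) :=
  (hΘ.central h).1.1

theorem map_zero (hΘ : IsCenterRep Θ) : Θ 0 = 0 := by
  simpa using hΘ.map_smul 0 0

theorem map_sub (hΘ : IsCenterRep Θ) (h h' : C(K, ℝ)) : Θ (h - h') = Θ h - Θ h' := by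
  rw [eq_sub_iff_add_eq, ← hΘ.map_add, sub_add_cancel]

theorem eq_of_forall_nonneg (hΘ : IsCenterRep Θ) {h h' : C(K, ℝ)}
    (H : ∀ f, 0 ≤ f → Θ h f = Θ h' f) : h = h' := by
  refine hΘ.inj (funext fun f => ?_)
  rw [← posPart_sub_negPart f, (hΘ.isLinearMap h).map_sub, (hΘ.isLinearMap h').map_sub,
    H _ (posPart_nonneg f), H _ (negPart_nonneg f)]

theorem mono (hΘ : IsCenterRep Θ) {h h' : C(K, ℝ)} (hh : h ≤ h') {f : D} (hf : 0 ≤ f) :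
    Θ h f ≤ Θ h' f := by
  have := hΘ.map_sup h h' f hf
  rw [sup_eq_right.2 hh] at this
  rw [this]
  exact le_sup_left

theorem le_of_forall_nonneg (hΘ : IsCenterRep Θ) {h h' : C(K, ℝ)}
    (H : ∀ f, 0 ≤ f → Θ h f ≤ Θ h' f) : h ≤ h' := by
  rw [← sup_eq_right]
  refine hΘ.eq_of_forall_nonneg fun f hf => ?_
  rw [hΘ.map_sup h h' f hf, sup_eq_right.2 (H f hf)]

theorem nonneg (hΘ : IsCenterRep Θ) {h : C(K, ℝ)} (hh : 0 ≤ h) {f : D} (hf : 0 ≤ f) :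
    0 ≤ Θ h f := by
  simpa [hΘ.map_zero] using hΘ.mono hh hf

theorem le_self (hΘ : IsCenterRep Θ) {h : C(K, ℝ)} (hh : h ≤ 1) {f : D} (hf : 0 ≤ f) :
    Θ h f ≤ f := by
  simpa [hΘ.map_one] using hΘ.mono hh hf

theorem exists_eq_of_linearMap (hΘ : IsCenterRep Θ) {L : D →ₗ[ℝ] D}
    (hL : ∀ x, 0 ≤ x → 0 ≤ L x ∧ L x ≤ x) :
    ∃ h : C(K, ℝ), 0 ≤ h ∧ h ≤ 1 ∧ ∀ x, Θ h x = L x := by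
  obtain ⟨h, hh⟩ := hΘ.surj L (isCentral_of_nonneg_of_le hL)
  refine ⟨h, hΘ.le_of_forall_nonneg fun f hf => ?_, hΘ.le_of_forall_nonneg fun f hf => ?_,
    fun x => congrFun hh x⟩
  · rw [hΘ.map_zero, hh]
    exact (hL f hf).1
  · rw [hΘ.map_one, hh]
    exact (hL f hf).2

/-- Upward directed subsets of the unit interval of `C(K)` have suprema, computed pointwise on
the positive cone of `D`. -/
theorem exists_pointwise_isLUB (hΘ : IsCenterRep Θ) (hD : IsOrderDual E D pE)
    {S : Set C(K, ℝ)} (hne : S.Nonempty) (hdir : DirectedOn (· ≤ ·) S)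
    (h01 : ∀ h ∈ S, 0 ≤ h ∧ h ≤ 1) :
    ∃ k : C(K, ℝ), 0 ≤ k ∧ k ≤ 1 ∧ (∀ h ∈ S, h ≤ k) ∧
      ∀ x, 0 ≤ x → IsLUB ((fun h => Θ h x) '' S) (Θ k x) := by
  have : Nonempty S := hne.to_subtype
  obtain ⟨L, hL⟩ := exists_linearMap_isLUB (fun h : S => Θ h) (fun h => hΘ.isLinearMap h)
    (fun i j => by
      obtain ⟨k, hk, h1, h2⟩ := hdir i i.2 j j.2
      exact ⟨⟨k, hk⟩, fun x hx => ⟨hΘ.mono h1 hx, hΘ.mono h2 hx⟩⟩)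
    (fun x hx => by
      obtain ⟨f, hf, -⟩ := hD.exists_isLUB (fun h : S => Θ h x)
        (fun i j => by
          obtain ⟨k, hk, h1, h2⟩ := hdir i i.2 j j.2
          exact ⟨⟨k, hk⟩, hΘ.mono h1 hx, hΘ.mono h2 hx⟩)
        x (fun h => hΘ.le_self (h01 h h.2).2 hx)
      exact ⟨f, hf⟩)
  obtain ⟨k, hk0, hk1, hk⟩ := hΘ.exists_eq_of_linearMap (L := L) (fun x hx => by
    obtain ⟨h, hh⟩ := hne
    refine ⟨(hΘ.nonneg (h01 h hh).1 hx).trans ((hL x hx).1 ⟨⟨h, hh⟩, rfl⟩), (hL x hx).2 ?_⟩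
    rintro _ ⟨h, rfl⟩
    exact hΘ.le_self (h01 h h.2).2 hx)
  refine ⟨k, hk0, hk1, fun h hh => hΘ.le_of_forall_nonneg fun f hf => ?_, fun x hx => ?_⟩
  · rw [hk]
    exact (hL f hf).1 ⟨⟨h, hh⟩, rfl⟩
  · rw [hk, Set.image_eq_range]
    exact hL x hx

/-- Evaluation at a positive element of `D` is order continuous on `C(K)`. -/
theorem isGLB_image (hΘ : IsCenterRep Θ) (hD : IsOrderDual E D pE) [CompactSpace K]
    {s : Set C(K, ℝ)} (hne : s.Nonempty) (hdir : DirectedOn (· ≥ ·) s) (hglb : IsGLB s 0)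
    {f : D} (hf : 0 ≤ f) : IsGLB ((fun h => Θ h f) '' s) 0 := by
  refine ⟨?_, fun l hl => ?_⟩
  · rintro _ ⟨h, hh, rfl⟩
    exact hΘ.nonneg (hglb.1 hh) hf
  obtain ⟨h₀, hh₀⟩ := hne
  obtain ⟨c, hc, hc₀⟩ : ∃ c : ℝ, 0 < c ∧ ∀ t, h₀ t ≤ c :=
    ⟨‖h₀‖ + 1, by positivity, fun t => by
      have := (le_abs_self _).trans (h₀.norm_coe_le_norm t)
      linarith⟩
  obtain ⟨k, -, -, hk, hk'⟩ := hΘ.exists_pointwise_isLUB hD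
    (S := (fun h => 1 - c⁻¹ • h) '' {h ∈ s | h ≤ h₀}) ⟨_, h₀, ⟨hh₀, le_rfl⟩, rfl⟩
    (by
      rintro _ ⟨h, ⟨hh, hhh⟩, rfl⟩ _ ⟨h', ⟨hh', hhh'⟩, rfl⟩
      obtain ⟨g, hg, h1, h2⟩ := hdir h hh h' hh'
      refine ⟨_, ⟨g, ⟨hg, (show g ≤ h from h1).trans hhh⟩, rfl⟩, ?_, ?_⟩
      · intro t
        exact sub_le_sub_left (mul_le_mul_of_nonneg_left (h1 t) (inv_nonneg.2 hc.le)) 1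
      · intro t
        exact sub_le_sub_left (mul_le_mul_of_nonneg_left (h2 t) (inv_nonneg.2 hc.le)) 1)
    (by
      rintro _ ⟨h, ⟨hh, hhh⟩, rfl⟩
      constructor
      · intro t
        have := mul_le_mul_of_nonneg_left ((hhh t).trans (hc₀ t)) (inv_nonneg.2 hc.le)
        rw [inv_mul_cancel₀ hc.ne'] at this
        simpa using this
      · intro t
        have := mul_nonneg (inv_nonneg.2 hc.le) (hglb.1 hh t)
        simpa using this)
  have hk1 : 1 ≤ k := by
    have h1 : c • (1 - k) ≤ 0 := hglb.2 fun h hh => by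
      obtain ⟨g, hg, h1, h2⟩ := hdir h hh h₀ hh₀
      refine le_trans (fun t => ?_) (show g ≤ h from h1)
      have h3 : 1 - c⁻¹ * g t ≤ k t := hk _ ⟨g, ⟨hg, h2⟩, rfl⟩ t
      have h4 := mul_le_mul_of_nonneg_left h3 hc.le
      rw [mul_sub, mul_inv_cancel_left₀ hc.ne'] at h4
      change c * (1 - k t) ≤ g t
      linarith
    intro t
    have h2 : c * (1 - k t) ≤ 0 := h1 t
    change 1 ≤ k t
    nlinarith
  have h1 : f ≤ f - c⁻¹ • l := by
    have h2 : f ≤ Θ k f := by simpa [hΘ.map_one] using hΘ.mono hk1 hf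
    refine h2.trans ((hk' f hf).2 ?_)
    rintro _ ⟨_, ⟨h, ⟨hh, -⟩, rfl⟩, rfl⟩
    have h3 := smul_le_smul_of_nonneg_left (hl ⟨h, hh, rfl⟩) (inv_nonneg.2 hc.le)
    simp only [hΘ.map_sub, hΘ.map_smul, Pi.sub_apply, Pi.smul_apply, hΘ.map_one]
    exact sub_le_sub_left h3 f
  have h2 : c⁻¹ • l ≤ 0 := by simpa using h1
  have h3 := smul_le_smul_of_nonneg_left h2 hc.le
  simpa [smul_smul, mul_inv_cancel₀ hc.ne'] using h3

theorem inf_smul_eq_zero {v w : D} {r : ℝ} (hr : 0 ≤ r) (hv : 0 ≤ v) (hw : 0 ≤ w)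
    (h : v ⊓ w = 0) : v ⊓ r • w = 0 := by
  have hc : (0 : ℝ) < max r 1 := lt_max_of_lt_right one_pos
  refine le_antisymm ?_ (le_inf hv (smul_nonneg hr hw))
  have h1 : (max r 1)⁻¹ • (v ⊓ r • w) ≤ v ⊓ w := by
    have h2 : ∀ {a b : D}, 0 ≤ b → a ≤ b → (max r 1)⁻¹ • a ≤ (max r 1)⁻¹ • b := fun _ hab =>
      smul_le_smul_of_nonneg_left hab (inv_nonneg.2 hc.le)
    refine le_inf ?_ ?_
    · refine (h2 hv inf_le_left).trans ?_
      have := smul_nonneg (sub_nonneg.2 (inv_le_one_of_one_le₀ (le_max_right r 1))) hv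
      rwa [sub_smul, one_smul, sub_nonneg] at this
    · refine (h2 (smul_nonneg hr hw) inf_le_right).trans ?_
      rw [smul_smul]
      have h3 : (max r 1)⁻¹ * r ≤ 1 := by
        rw [inv_mul_le_one₀ hc]
        exact le_max_left r 1
      have := smul_nonneg (sub_nonneg.2 h3) hw
      rwa [sub_smul, one_smul, sub_nonneg] at this
  rw [h] at h1
  have h3 := smul_le_smul_of_nonneg_left h1 hc.le
  simpa [smul_smul, mul_inv_cancel₀ hc.ne'] using h3

/-- The band projection onto the band generated by `w ≥ 0`. -/
theorem exists_bandProjection (hΘ : IsCenterRep Θ) (hD : IsOrderDual E D pE) {w : D}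
    (hw : 0 ≤ w) :
    ∃ e : C(K, ℝ), 0 ≤ e ∧ e ≤ 1 ∧ Θ e w = w ∧ ∀ v, 0 ≤ v → v ⊓ w = 0 → Θ e v = 0 := by
  have hmono : ∀ {r r' : NNReal}, r ≤ r' → (r : ℝ) • w ≤ (r' : ℝ) • w := fun {r r'} h => by
    have := smul_nonneg (sub_nonneg.2 (NNReal.coe_le_coe.2 h)) hw
    rwa [sub_smul, sub_nonneg] at this
  have hmono' : ∀ (x : D) {r r' : NNReal}, r ≤ r' →
      x ⊓ (r : ℝ) • w ≤ x ⊓ (r' : ℝ) • w := fun x _ _ h => inf_le_inf_left x (hmono h)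
  have hex : ∀ x : D, ∃ y, IsLUB (Set.range fun r : NNReal => x ⊓ (r : ℝ) • w) y := fun x => by
    obtain ⟨f, hf, -⟩ := hD.exists_isLUB (fun r : NNReal => x ⊓ (r : ℝ) • w)
      (fun i j => ⟨max i j, hmono' x (le_max_left i j), hmono' x (le_max_right i j)⟩)
      x (fun _ => inf_le_left)
    exact ⟨f, hf⟩
  choose T hT using hex
  have hadd : ∀ x y, 0 ≤ x → 0 ≤ y → T (x + y) = T x + T y := by
    intro x y hx hy
    have h1 := isLUB_range_add_of_directed (fun i j =>
      ⟨max i j, hmono' x (le_max_left i j), hmono' y (le_max_right i j)⟩) (hT x) (hT y)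
    refine le_antisymm ((hT _).2 ?_) (h1.2 ?_)
    · rintro _ ⟨r, rfl⟩
      refine le_trans ?_ (h1.1 ⟨r, rfl⟩)
      have hr := smul_nonneg r.2 hw
      simp only [add_inf, inf_add]
      refine le_inf (le_inf inf_le_left ?_) (le_inf ?_ ?_)
      · exact inf_le_right.trans (le_add_of_nonneg_right hy)
      · exact inf_le_right.trans (le_add_of_nonneg_left hx)
      · exact inf_le_right.trans (le_add_of_nonneg_right hr)
    · rintro _ ⟨r, rfl⟩
      refine le_trans ?_ ((hT (x + y)).1 ⟨r + r, rfl⟩)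
      change _ ≤ (x + y) ⊓ ((r : ℝ) + r) • w
      rw [add_smul]
      exact le_inf (add_le_add inf_le_left inf_le_left) (add_le_add inf_le_right inf_le_right)
  have hT0 : ∀ x, 0 ≤ x → 0 ≤ T x := fun x hx =>
    (le_inf hx (by simp)).trans ((hT x).1 ⟨0, rfl⟩)
  have hTle : ∀ x, T x ≤ x := fun x => (hT x).2 (by
    rintro _ ⟨r, rfl⟩
    exact inf_le_left)
  have hsmul_le : ∀ (c : ℝ) (x : D), 0 < c → c • T x ≤ T (c • x) := by
    intro c x hc
    refine (isLUB_range_smul hc (hT x)).2 ?_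
    rintro _ ⟨r, rfl⟩
    obtain ⟨c, rfl⟩ : ∃ c' : NNReal, (c' : ℝ) = c := ⟨⟨c, hc.le⟩, rfl⟩
    refine le_trans (le_inf ?_ ?_) ((hT ((c : ℝ) • x)).1 ⟨c * r, rfl⟩)
    · exact smul_le_smul_of_nonneg_left inf_le_left hc.le
    · change _ ≤ ((c : ℝ) * (r : ℝ)) • w
      rw [mul_smul]
      exact smul_le_smul_of_nonneg_left inf_le_right hc.le
  have hsmul : ∀ (c : ℝ) (x : D), 0 ≤ c → 0 ≤ x → T (c • x) = c • T x := by
    intro c x hc hx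
    rcases hc.eq_or_lt with rfl | hc
    · rw [zero_smul, zero_smul]
      exact le_antisymm (hTle 0) (hT0 0 le_rfl)
    · refine le_antisymm ?_ (hsmul_le c x hc)
      have h1 := hsmul_le c⁻¹ (c • x) (inv_pos.2 hc)
      rw [smul_smul, inv_mul_cancel₀ hc.ne', one_smul] at h1
      have h2 := smul_le_smul_of_nonneg_left h1 hc.le
      rwa [smul_smul, mul_inv_cancel₀ hc.ne', one_smul] at h2
  obtain ⟨L, hL⟩ := exists_linearMap_eq_of_nonneg T hadd hsmul
  obtain ⟨e, he0, he1, he⟩ := hΘ.exists_eq_of_linearMap (L := L) fun x hx => by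
    rw [hL x hx]
    exact ⟨hT0 x hx, hTle x⟩
  refine ⟨e, he0, he1, ?_, fun v hv hvw => ?_⟩
  · rw [he, hL w hw]
    refine le_antisymm (hTle w) ?_
    have := (hT w).1 ⟨1, rfl⟩
    simpa using this
  · rw [he, hL v hv]
    refine le_antisymm ((hT v).2 ?_) (hT0 v hv)
    rintro _ ⟨r, rfl⟩
    exact (inf_smul_eq_zero r.2 hv hw hvw).le

/-- If `0 ≤ g ≤ f` then `g` is the image of `f` under a largest central operator
between `0` and `1`. -/
theorem exists_greatest_apply_eq (hΘ : IsCenterRep Θ) (hD : IsOrderDual E D pE) {f g : D}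
    (hg : 0 ≤ g) (hgf : g ≤ f) :
    ∃ k : C(K, ℝ), 0 ≤ k ∧ k ≤ 1 ∧ Θ k f = g ∧
      ∀ h : C(K, ℝ), 0 ≤ h → h ≤ 1 → Θ h f ≤ g → h ≤ k := by
  have hf : 0 ≤ f := hg.trans hgf
  obtain ⟨k, hk0, hk1, hk, hk'⟩ := hΘ.exists_pointwise_isLUB hD
    (S := {h | (0 ≤ h ∧ h ≤ 1) ∧ Θ h f ≤ g})
    ⟨0, ⟨le_rfl, fun _ => zero_le_one⟩, by rwa [hΘ.map_zero]⟩
    (by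
      rintro h ⟨⟨h0, h1⟩, h2⟩ h' ⟨⟨h0', h1'⟩, h2'⟩
      refine ⟨h ⊔ h', ⟨⟨h0.trans le_sup_left, sup_le h1 h1'⟩, ?_⟩, le_sup_left, le_sup_right⟩
      rw [hΘ.map_sup h h' f hf]
      exact sup_le h2 h2')
    (fun h hh => hh.1)
  have hkg : Θ k f ≤ g := (hk' f hf).2 (by
    rintro _ ⟨h, hh, rfl⟩
    exact hh.2)
  refine ⟨k, hk0, hk1, ?_, fun h h0 h1 h2 => hk h ⟨⟨h0, h1⟩, h2⟩⟩
  refine le_antisymm hkg ?_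
  rw [← sub_nonpos]
  refine hD.nonpos_of_forall_le_smul (f := f) fun ε hε => ?_
  set u := g - Θ k f with hu
  have hu0 : 0 ≤ u := sub_nonneg.2 hkg
  obtain ⟨e, he0, he1, hew, hev⟩ := hΘ.exists_bandProjection hD (posPart_nonneg (u - ε • f))
  have hle : ε • Θ e f ≤ u := by
    have h1 : Θ e (u - ε • f) = (u - ε • f)⁺ := by
      rw [← posPart_sub_negPart (u - ε • f), (hΘ.isLinearMap e).map_sub,
        posPart_sub_negPart, hew, hev _ (negPart_nonneg _), sub_zero]
      rw [inf_comm]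
      exact posPart_inf_negPart_eq_zero _
    rw [(hΘ.isLinearMap e).map_sub, (hΘ.isLinearMap e).map_smul] at h1
    have h2 : 0 ≤ Θ e u - ε • Θ e f := h1 ▸ posPart_nonneg _
    exact (sub_nonneg.1 h2).trans (hΘ.le_self he1 hu0)
  have hmem : (k + ε • e) ⊓ 1 ≤ k := by
    refine hk _ ⟨⟨le_inf (fun t => ?_) (fun _ => zero_le_one), inf_le_right⟩, ?_⟩
    · exact add_nonneg (hk0 t) (mul_nonneg hε.le (he0 t))
    · refine (hΘ.mono inf_le_left hf).trans ?_
      rw [hΘ.map_add, hΘ.map_smul]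
      change Θ k f + ε • Θ e f ≤ g
      rw [← le_sub_iff_add_le']
      exact hle
  have hek : e * (1 - k) = 0 := by
    ext t
    have h1 : min (k t + ε * e t) 1 ≤ k t := hmem t
    have h2 : k t ≤ 1 := hk1 t
    have h3 : 0 ≤ e t := he0 t
    change e t * (1 - k t) = 0
    rcases h2.eq_or_lt with h2 | h2
    · simp [h2]
    · have h4 : k t + ε * e t ≤ k t := by
        rcases min_le_iff.1 h1 with h | h
        · exact h
        · linarith
      have h5 : e t = 0 := by nlinarith
      simp [h5]
  have heu : Θ e u = 0 := by
    refine le_antisymm ?_ (hΘ.nonneg he0 hu0)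
    have h1 : Θ (e * (1 - k)) f = 0 := by rw [hek, hΘ.map_zero]; rfl
    rw [hΘ.map_mul, hΘ.map_sub, Pi.sub_apply, hΘ.map_one] at h1
    rw [← h1, ← sub_nonneg, ← (hΘ.isLinearMap e).map_sub]
    refine hΘ.nonneg he0 ?_
    rw [hu, sub_sub_sub_cancel_right, sub_nonneg]
    exact hgf
  have hw0 : (u - ε • f)⁺ ≤ 0 := by
    have h1 : (u - ε • f)⁺ ≤ u :=
      sup_le (sub_le_self _ (smul_nonneg hε.le hf)) hu0
    rw [← hew, ← heu, ← sub_nonneg, ← (hΘ.isLinearMap e).map_sub]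
    exact hΘ.nonneg he0 (sub_nonneg.2 h1)
  exact sub_nonpos.1 ((le_posPart _).trans hw0)

theorem exists_least_apply_eq (hΘ : IsCenterRep Θ) (hD : IsOrderDual E D pE) {f g : D}
    (hg : 0 ≤ g) (hgf : g ≤ f) :
    ∃ k : C(K, ℝ), 0 ≤ k ∧ k ≤ 1 ∧ Θ k f = g ∧
      ∀ h : C(K, ℝ), 0 ≤ h → h ≤ 1 → g ≤ Θ h f → k ≤ h := by
  obtain ⟨k, hk0, hk1, hk, hmax⟩ := hΘ.exists_greatest_apply_eq hD (f := f) (g := f - g)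
    (sub_nonneg.2 hgf) (sub_le_self f hg)
  have hsub : ∀ h : C(K, ℝ), Θ (1 - h) f = f - Θ h f := fun h => by
    rw [hΘ.map_sub, Pi.sub_apply, hΘ.map_one]
  refine ⟨1 - k, sub_nonneg.2 hk1, sub_le_self 1 hk0, by rw [hsub, hk, sub_sub_cancel],
    fun h h0 h1 h2 => ?_⟩
  have := hmax (1 - h) (sub_nonneg.2 h1) (sub_le_self 1 h0) (by
    rw [hsub]
    exact sub_le_sub_left h2 f)
  exact sub_le_comm.1 this

variable {φ : D → ℝ}

theorem isOrderContinuousFun_comp (hΘ : IsCenterRep Θ) (hD : IsOrderDual E D pE)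
    [CompactSpace K] (hφ : IsLinearMap ℝ φ) (hoc : IsOrderContinuousFun φ) (f : D) :
    IsOrderContinuousFun fun h => φ (Θ h f) := by
  have hpos : ∀ f : D, 0 ≤ f → IsOrderContinuousFun fun h => φ (Θ h f) := by
    intro f hf s hs hdir hglb ε hε
    obtain ⟨_, ⟨h, hh, rfl⟩, H⟩ := hoc ((fun h => Θ h f) '' s) (hs.image _)
      (by
        rintro _ ⟨h, hh, rfl⟩ _ ⟨h', hh', rfl⟩
        obtain ⟨g, hg, h1, h2⟩ := hdir h hh h' hh'
        exact ⟨_, ⟨g, hg, rfl⟩, hΘ.mono h1 hf, hΘ.mono h2 hf⟩)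
      (hΘ.isGLB_image hD hs hdir hglb hf) ε hε
    exact ⟨h, hh, fun y hy hyh => H _ ⟨y, hy, rfl⟩ (hΘ.mono hyh hf)⟩
  have h1 := (hpos _ (posPart_nonneg f)).sub (hpos _ (negPart_nonneg f))
  convert h1 using 2 with h
  rw [← hφ.map_sub, ← (hΘ.isLinearMap h).map_sub, posPart_sub_negPart]

theorem isOrderContinuousFun_of_comp (hΘ : IsCenterRep Θ) (hD : IsOrderDual E D pE)
    (hoc : ∀ f, IsOrderContinuousFun fun h => φ (Θ h f)) : IsOrderContinuousFun φ := by
  intro s hs hdir hglb ε hε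
  obtain ⟨f, hfs⟩ := hs
  have hex : ∀ g : D, ∃ k : C(K, ℝ), g ∈ s → g ≤ f → 0 ≤ k ∧ k ≤ 1 ∧ Θ k f = g ∧
      ∀ h : C(K, ℝ), 0 ≤ h → h ≤ 1 → g ≤ Θ h f → k ≤ h := by
    intro g
    by_cases h : g ∈ s ∧ g ≤ f
    · obtain ⟨k, hk⟩ := hΘ.exists_least_apply_eq hD (hglb.1 h.1) h.2
      exact ⟨k, fun _ _ => hk⟩
    · exact ⟨0, fun h1 h2 => absurd ⟨h1, h2⟩ h⟩
  choose k hk using hex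
  have hkmono : ∀ g g', g ∈ s → g' ∈ s → g ≤ g' → g' ≤ f → k g ≤ k g' := by
    intro g g' hg hg' hgg hgf
    obtain ⟨h0, h1, h2, -⟩ := hk g' hg' hgf
    exact (hk g hg (hgg.trans hgf)).2.2.2 _ h0 h1 (by rwa [h2])
  obtain ⟨_, ⟨g, ⟨hg, hgf⟩, rfl⟩, H⟩ := hoc f (k '' {g ∈ s | g ≤ f})
    ⟨_, f, ⟨hfs, le_rfl⟩, rfl⟩
    (by
      rintro _ ⟨g, ⟨hg, hgf⟩, rfl⟩ _ ⟨g', ⟨hg', hgf'⟩, rfl⟩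
      obtain ⟨l, hl, h1, h2⟩ := hdir g hg g' hg'
      exact ⟨_, ⟨l, ⟨hl, (show l ≤ g from h1).trans hgf⟩, rfl⟩,
        hkmono l g hl hg h1 hgf, hkmono l g' hl hg' h2 hgf'⟩)
    (by
      constructor
      · rintro _ ⟨g, ⟨hg, hgf⟩, rfl⟩
        exact (hk g hg hgf).1
      · intro l hl
        have hl' : ∀ g ∈ s, g ≤ f → l ⊔ 0 ≤ k g := fun g hg hgf =>
          sup_le (hl ⟨g, ⟨hg, hgf⟩, rfl⟩) (hk g hg hgf).1
        have hf0 : 0 ≤ f := hglb.1 hfs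
        have h0 : Θ (l ⊔ 0) f = 0 := by
          refine le_antisymm (hglb.2 fun g hg => ?_) (hΘ.nonneg le_sup_right hf0)
          obtain ⟨g', hg', h1, h2⟩ := hdir g hg f hfs
          refine le_trans ?_ (show g' ≤ g from h1)
          rw [← (hk g' hg' h2).2.2.1]
          exact hΘ.mono (hl' g' hg' h2) hf0
        obtain ⟨hk0, hk1, hk2, hk3⟩ := hk f hfs le_rfl
        have h1 := hk3 (k f - l ⊔ 0) (sub_nonneg.2 (hl' f hfs le_rfl))
          ((sub_le_self _ le_sup_right).trans hk1)
          (by rw [hΘ.map_sub, Pi.sub_apply, hk2, h0, sub_zero])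
        have h2 : l ⊔ 0 ≤ 0 := by simpa using h1
        exact le_sup_left.trans h2)
    ε hε
  refine ⟨g, hg, fun y hy hyg => ?_⟩
  have h1 := H (k y) ⟨y, ⟨hy, hyg.trans hgf⟩, rfl⟩ (hkmono y g hy hg hyg hgf)
  simpa only [(hk y hy (hyg.trans hgf)).2.2.1] using h1

end IsCenterRep

theorem exists_forall_abs_apply_le {Z : Type*} [NormedRing Z] [NormedAlgebra ℝ Z]
    (F : (Z →L[ℝ] ℝ) →L[ℝ] ℝ) : ∃ C : ℝ, 0 ≤ C ∧ ∀ ν, |F ν| ≤ C * ‖ν‖ :=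
  ⟨‖F‖, norm_nonneg F, F.le_opNorm⟩

section ArensC

variable {K : Type*} [TopologicalSpace K] [CompactSpace K]

local notation "CK" => C(K, ℝ)

theorem arensMul_apply (F G : (CK →L[ℝ] ℝ) →L[ℝ] ℝ) (μ : CK →L[ℝ] ℝ) :
    arensMul CK F G μ = F (arensFDot CK G μ) := rfl

theorem arensFDot_apply (F : (CK →L[ℝ] ℝ) →L[ℝ] ℝ) (μ : CK →L[ℝ] ℝ) (a : CK) :
    arensFDot CK F μ a = F (arensDotL CK μ a) := rfl

theorem arensDotL_apply (μ : CK →L[ℝ] ℝ) (a b : CK) : arensDotL CK μ a b = μ (a * b) := rfl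

theorem arensDotL_one (μ : CK →L[ℝ] ℝ) : arensDotL CK μ 1 = μ := by
  ext b
  rw [arensDotL_apply, one_mul]

theorem arensFDot_one (F : (CK →L[ℝ] ℝ) →L[ℝ] ℝ) (μ : CK →L[ℝ] ℝ) :
    arensFDot CK F μ 1 = F μ := by
  rw [arensFDot_apply, arensDotL_one]

theorem arensFDot_arensOne (μ : CK →L[ℝ] ℝ) : arensFDot CK (arensOne CK) μ = μ := by
  ext a
  change μ (a * 1) = μ a
  rw [mul_one]

theorem arensFDot_sub_left (F G : (CK →L[ℝ] ℝ) →L[ℝ] ℝ) (μ : CK →L[ℝ] ℝ) :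
    arensFDot CK (F - G) μ = arensFDot CK F μ - arensFDot CK G μ := rfl

theorem arensDotL_arensFDot (F : (CK →L[ℝ] ℝ) →L[ℝ] ℝ) (μ : CK →L[ℝ] ℝ) (a : CK) :
    arensDotL CK (arensFDot CK F μ) a = arensFDot CK F (arensDotL CK μ a) := by
  ext b
  rw [arensDotL_apply, arensFDot_apply, arensFDot_apply]
  congr 1
  ext c
  simp only [arensDotL_apply, mul_assoc]

theorem dualNonneg_arensDotL {μ : CK →L[ℝ] ℝ} (hμ : dualNonneg μ) {a : CK} (ha : 0 ≤ a) :
    dualNonneg (arensDotL CK μ a) := fun b hb => by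
  rw [arensDotL_apply]
  exact hμ _ fun t => mul_nonneg (ha t) (hb t)

theorem dualNonneg.mono {μ : CK →L[ℝ] ℝ} (hμ : dualNonneg μ) : Monotone μ := fun a b hab => by
  have := hμ _ (sub_nonneg.2 hab)
  rwa [map_sub, sub_nonneg] at this

theorem dualNonneg.apply_mul_self_le {μ : CK →L[ℝ] ℝ} (hμ : dualNonneg μ) {b : CK}
    (hb : ‖b‖ = 1) : μ (b * b) ≤ μ 1 := by
  refine hμ.mono fun t => ?_
  have h1 := b.norm_coe_le_norm t
  rw [hb, Real.norm_eq_abs, abs_le] at h1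
  change b t * b t ≤ 1
  nlinarith

theorem dualNonneg.norm_arensDotL_le {μ : CK →L[ℝ] ℝ} (hμ : dualNonneg μ) (a : CK) {r : ℝ}
    (hr : 0 < r) : 2 * ‖arensDotL CK μ a‖ ≤ r * μ (a * a) + r⁻¹ * μ 1 := by
  have haa : 0 ≤ μ (a * a) := hμ _ fun t => mul_self_nonneg (a t)
  have h1 : 0 ≤ μ 1 := hμ _ fun _ => zero_le_one
  have h2 : ‖arensDotL CK μ a‖ ≤ (r * μ (a * a) + r⁻¹ * μ 1) / 2 := by
    refine ContinuousLinearMap.opNorm_le_of_unit_norm (by positivity) fun b hb => ?_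
    rw [arensDotL_apply, Real.norm_eq_abs]
    have hbb := hμ.apply_mul_self_le hb
    have hbb' := mul_le_mul_of_nonneg_left hbb (inv_nonneg.2 hr.le)
    have key : ∀ c : ℝ, c ^ 2 = 1 → c * (2 * μ (a * b)) ≤ r * μ (a * a) + r⁻¹ * μ (b * b) := by
      intro c hc
      have h3 : 0 ≤ μ (r⁻¹ • ((r • a - c • b) * (r • a - c • b))) :=
        hμ _ fun t => mul_nonneg (inv_nonneg.2 hr.le) (mul_self_nonneg _)
      have h4 : r⁻¹ • ((r • a - c • b) * (r • a - c • b)) =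
          r • (a * a) - (2 * c) • (a * b) + r⁻¹ • (b * b) := by
        ext t
        simp only [ContinuousMap.smul_apply, ContinuousMap.mul_apply, ContinuousMap.sub_apply,
          ContinuousMap.add_apply, smul_eq_mul]
        field_simp
        linear_combination (b t) ^ 2 * hc
      rw [h4, map_add, map_sub, map_smul, map_smul, map_smul] at h3
      simp only [smul_eq_mul] at h3
      linarith
    rw [abs_le]
    have k1 := key 1 (by norm_num)
    have k2 := key (-1) (by norm_num)
    constructor <;> linarith
  linarith

/-- For a positive functional `μ`, the functional `F ⬝ μ` is approximated by `μ ⬝ a`,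
by minimizing the quadratic functional `a ↦ μ(a²) - 2 (F ⬝ μ)(a)`. -/
theorem exists_norm_arensDotL_sub_le (F : (CK →L[ℝ] ℝ) →L[ℝ] ℝ) {μ : CK →L[ℝ] ℝ}
    (hμ : dualNonneg μ) {η : ℝ} (hη : 0 < η) :
    ∃ a : CK, ‖arensDotL CK μ a - arensFDot CK F μ‖ ≤ η * (1 + μ 1) ∧
      -(η ^ 2) ≤ 2 * arensFDot CK F μ a := by
  set ψ := arensFDot CK F μ with hψ
  have h1 : 0 ≤ μ 1 := hμ _ fun _ => zero_le_one
  have haa : ∀ a : CK, 0 ≤ μ (a * a) := fun a => hμ _ fun t => mul_self_nonneg (a t)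
  obtain ⟨C, hF, hC⟩ := exists_forall_abs_apply_le F
  let Q : CK → ℝ := fun a => μ (a * a) - 2 * ψ a
  have hQ : BddBelow (Set.range Q) := by
    refine ⟨-(C * (C + 1) * μ 1), ?_⟩
    rintro _ ⟨a, rfl⟩
    have h2 := dualNonneg.norm_arensDotL_le hμ a (r := (C + 1)⁻¹) (by positivity)
    rw [inv_inv] at h2
    have h3 : ψ a ≤ C * ‖arensDotL CK μ a‖ :=
      (le_abs_self _).trans (hC (arensDotL CK μ a))
    have h4 := mul_le_mul_of_nonneg_left h2 hF
    have h5 : C * (C + 1)⁻¹ ≤ 1 := by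
      rw [← div_eq_mul_inv, div_le_one (by positivity)]
      linarith
    have h6 := mul_le_mul_of_nonneg_right h5 (haa a)
    change -(C * (C + 1) * μ 1) ≤ μ (a * a) - 2 * ψ a
    linarith
  obtain ⟨_, ⟨a, rfl⟩, ha⟩ := exists_lt_of_csInf_lt (Set.range_nonempty Q)
    (lt_add_of_pos_right (sInf (Set.range Q)) (pow_pos hη 2))
  have hmin : ∀ c, Q a ≤ Q c + η ^ 2 := fun c => by
    have := csInf_le hQ ⟨c, rfl⟩
    linarith
  refine ⟨a, ?_, ?_⟩
  · refine ContinuousLinearMap.opNorm_le_of_unit_norm (by positivity) fun b hb => ?_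
    rw [sub_apply, arensDotL_apply, Real.norm_eq_abs]
    have hbb := hμ.apply_mul_self_le hb
    have key : ∀ s : ℝ, 0 ≤ 2 * s * (μ (a * b) - ψ b) + s ^ 2 * μ (b * b) + η ^ 2 := by
      intro s
      have h2 := hmin (a + s • b)
      have h3 : (a + s • b) * (a + s • b) =
          a * a + (2 * s) • (a * b) + (s ^ 2) • (b * b) := by
        ext t
        simp only [ContinuousMap.smul_apply, ContinuousMap.mul_apply,
          ContinuousMap.add_apply, smul_eq_mul]
        ring
      simp only [Q, h3, map_add, map_smul, smul_eq_mul] at h2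
      linarith
    have k1 := key η
    have k2 := key (-η)
    have h4 : η ^ 2 * μ (b * b) ≤ η ^ 2 * μ 1 := mul_le_mul_of_nonneg_left hbb (sq_nonneg η)
    have h5 : 0 ≤ η ^ 2 * μ 1 := by positivity
    rw [abs_le]
    constructor
    · refine le_of_mul_le_mul_left ?_ hη
      nlinarith
    · refine le_of_mul_le_mul_left ?_ hη
      nlinarith
  · have h2 := hmin 0
    simp only [Q, mul_zero, map_zero, sub_zero, zero_add] at h2
    have := haa a
    linarith

theorem arensFDot_apply_nonneg_of_idem {F : (CK →L[ℝ] ℝ) →L[ℝ] ℝ}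
    (hF : ∀ μ, F (arensFDot CK F μ) = F μ) {μ : CK →L[ℝ] ℝ} (hμ : dualNonneg μ) : 0 ≤ F μ := by
  have h1 : 0 ≤ μ 1 := hμ _ fun _ => zero_le_one
  obtain ⟨C, hF0, hC⟩ := exists_forall_abs_apply_le F
  refine le_of_forall_pos_lt_add fun ε hε => ?_
  set M := C * (1 + μ 1) + 1 with hM
  have hM0 : 0 < M := by positivity
  set η := min 1 (ε / (2 * M)) with hηdef
  have hη : 0 < η := lt_min one_pos (by positivity)
  obtain ⟨a, ha, ha'⟩ := exists_norm_arensDotL_sub_le F hμ hη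
  have h2 : |F (arensDotL CK μ a - arensFDot CK F μ)| ≤ C * (η * (1 + μ 1)) :=
    (hC _).trans (mul_le_mul_of_nonneg_left ha hF0)
  rw [map_sub, hF, ← arensFDot_apply, abs_le] at h2
  have h3 : η ^ 2 ≤ η := by nlinarith [min_le_left 1 (ε / (2 * M))]
  have h4 : η * M ≤ ε / 2 := by
    calc η * M ≤ ε / (2 * M) * M := mul_le_mul_of_nonneg_right (min_le_right _ _) hM0.le
      _ = ε / 2 := by field_simp
  have h5 : η * M = C * (η * (1 + μ 1)) + η := by rw [hM]; ring
  linarith [h2.2]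

theorem dualNonneg_arensFDot_of_idem {F : (CK →L[ℝ] ℝ) →L[ℝ] ℝ}
    (hF : ∀ μ, F (arensFDot CK F μ) = F μ) {μ : CK →L[ℝ] ℝ} (hμ : dualNonneg μ) :
    dualNonneg (arensFDot CK F μ) := fun _ ha =>
  arensFDot_apply_nonneg_of_idem hF (dualNonneg_arensDotL hμ ha)

theorem idem_one_sub {F : (CK →L[ℝ] ℝ) →L[ℝ] ℝ} (hF : ∀ μ, F (arensFDot CK F μ) = F μ)
    (μ : CK →L[ℝ] ℝ) :
    (arensOne CK - F) (arensFDot CK (arensOne CK - F) μ) = (arensOne CK - F) μ := by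
  have h1 : ∀ ν : CK →L[ℝ] ℝ, arensOne CK ν = ν 1 := fun _ => rfl
  rw [arensFDot_sub_left, arensFDot_arensOne, map_sub]
  simp only [sub_apply, h1, arensFDot_one, hF]
  ring

/-- Two positive functionals separated by an element of the bidual are disjoint. -/
theorem exists_apply_add_apply_le {F : (CK →L[ℝ] ℝ) →L[ℝ] ℝ} {lam μ : CK →L[ℝ] ℝ}
    (hlam : dualNonneg lam) (hμ : dualNonneg μ)
    (hFlam : arensFDot CK F lam = lam) (hFμ : arensFDot CK F μ = 0) {ε : ℝ} (hε : 0 < ε) :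
    ∃ c : CK, 0 ≤ c ∧ c ≤ 1 ∧ lam (1 - c) ≤ ε ∧ μ c ≤ ε := by
  have hτ : dualNonneg (lam + μ) := fun a ha => add_nonneg (hlam a ha) (hμ a ha)
  have hadd : ∀ a, arensDotL CK (lam + μ) a = arensDotL CK lam a + arensDotL CK μ a :=
    fun _ => rfl
  have hFτ : arensFDot CK F (lam + μ) = lam := by
    ext a
    have h1 : arensFDot CK F lam a + arensFDot CK F μ a = lam a := by
      rw [hFlam, hFμ, zero_apply, add_zero]
    rw [← h1, arensFDot_apply, hadd, map_add]
    rfl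
  have h1 : 0 ≤ (lam + μ) 1 := hτ _ fun _ => zero_le_one
  obtain ⟨C, hF0, hC⟩ := exists_forall_abs_apply_le F
  set M := 2 * (C + 1) * (1 + (lam + μ) 1) with hM
  have hM0 : 0 < M := by positivity
  obtain ⟨a, ha, -⟩ := exists_norm_arensDotL_sub_le F hτ (div_pos hε hM0)
  rw [hFτ] at ha
  set δ := ε / M * (1 + (lam + μ) 1) with hδ
  have hδε : 2 * (C + 1) * δ = ε := by
    rw [hδ, hM]
    field_simp
  set ρ := arensDotL CK (lam + μ) a - lam with hρ
  -- Test `ρ` and `F ⬝ ρ` on elements of norm at most `2`.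
  have hρb : ∀ b : CK, ‖b‖ ≤ 2 → |ρ b| ≤ 2 * δ := fun b hb => by
    have h2 := ρ.le_opNorm b
    have h3 := mul_le_mul ha hb (norm_nonneg b) ((norm_nonneg _).trans ha)
    rw [Real.norm_eq_abs] at h2
    linarith
  have hFρ : ∀ b, arensFDot CK F ρ b = lam (a * b) - lam b := fun b => by
    have h2 : arensDotL CK ρ b =
        arensDotL CK (lam + μ) (a * b) - arensDotL CK lam b := by
      ext c
      simp only [hρ, arensDotL_apply, sub_apply, mul_assoc]
    rw [arensFDot_apply, h2, map_sub, ← arensFDot_apply, ← arensFDot_apply, hFτ, hFlam]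
  have hFρb : ∀ b : CK, ‖b‖ ≤ 2 → |lam (a * b) - lam b| ≤ C * (2 * δ) := fun b hb => by
    rw [← hFρ, arensFDot_apply]
    refine (hC _).trans (mul_le_mul_of_nonneg_left ?_ hF0)
    have hδ0 : 0 ≤ δ := (norm_nonneg _).trans ha
    refine ContinuousLinearMap.opNorm_le_of_unit_norm (by positivity) fun c hc => ?_
    rw [arensDotL_apply]
    refine hρb _ ((norm_mul_le b c).trans ?_)
    rw [hc, mul_one]
    exact hb
  have hμb : ∀ b : CK, ‖b‖ ≤ 2 → |μ (a * b)| ≤ (C + 1) * (2 * δ) := fun b hb => by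
    have h2 : μ (a * b) = ρ b - (lam (a * b) - lam b) := by
      simp only [hρ, sub_apply, arensDotL_apply,
        add_apply]
      ring
    have h3 := hρb b hb
    have h4 := hFρb b hb
    rw [h2]
    rw [abs_le] at *
    constructor <;> linarith
  have hden : ∀ t, 0 < (a t) ^ 2 + (1 - a t) ^ 2 := fun t => by nlinarith [sq_nonneg (2 * a t - 1)]
  let d : CK := ⟨fun t => ((a t) ^ 2 + (1 - a t) ^ 2)⁻¹, by
    refine Continuous.inv₀ (by fun_prop) fun t => (hden t).ne'⟩
  have hd : ∀ t, d t * ((a t) ^ 2 + (1 - a t) ^ 2) = 1 := fun t => inv_mul_cancel₀ (hden t).ne'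
  have hd0 : ∀ t, 0 < d t := fun t => inv_pos.2 (hden t)
  have hnorm : ‖a * d‖ ≤ 2 ∧ ‖(1 - a) * d‖ ≤ 2 := by
    constructor
    · refine (ContinuousMap.norm_le _ (by norm_num)).2 fun t => ?_
      change |a t * d t| ≤ 2
      have h2 := hd t
      have h3 := hd0 t
      rw [abs_le]
      constructor
      · nlinarith [mul_nonneg h3.le (sq_nonneg (8 * a t - 3))]
      · nlinarith [mul_nonneg h3.le (sq_nonneg (8 * a t - 5))]
    · refine (ContinuousMap.norm_le _ (by norm_num)).2 fun t => ?_
      change |(1 - a t) * d t| ≤ 2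
      have h2 := hd t
      have h3 := hd0 t
      rw [abs_le]
      constructor
      · nlinarith [mul_nonneg h3.le (sq_nonneg (8 * (1 - a t) - 3))]
      · nlinarith [mul_nonneg h3.le (sq_nonneg (8 * (1 - a t) - 5))]
  have hsub : 1 - a * (a * d) = (1 - a) * ((1 - a) * d) := by
    ext t
    change 1 - a t * (a t * d t) = (1 - a t) * ((1 - a t) * d t)
    linear_combination -(hd t)
  have hle : 0 ≤ 1 - a * (a * d) := by
    rw [hsub]
    intro t
    change 0 ≤ (1 - a t) * ((1 - a t) * d t)
    rw [← mul_assoc]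
    exact mul_nonneg (mul_self_nonneg _) (hd0 t).le
  refine ⟨a * (a * d), fun t => ?_, sub_nonneg.1 hle, ?_, ?_⟩
  · change 0 ≤ a t * (a t * d t)
    rw [← mul_assoc]
    exact mul_nonneg (mul_self_nonneg _) (hd0 t).le
  · have h2 := (abs_le.1 (hFρb _ hnorm.2)).1
    have h3 : (1 - a) * ((1 - a) * d) = (1 - a) * d - a * ((1 - a) * d) := by ring
    have hδ0 : 0 ≤ δ := (norm_nonneg _).trans ha
    rw [hsub, h3, map_sub]
    linarith
  · have h2 := (abs_le.1 (hμb _ hnorm.1)).2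
    linarith

end ArensC

section Disjointness

variable {K : Type*} [TopologicalSpace K] [CompactSpace K]

local notation "CK" => C(K, ℝ)

theorem exists_pos_le_apply_eq_zero {F : (CK →L[ℝ] ℝ) →L[ℝ] ℝ} {lam μ : CK →L[ℝ] ℝ}
    (hlam : dualNonneg lam) (hμ : dualNonneg μ) (hoc : IsOrderContinuousFun μ)
    (hFlam : arensFDot CK F lam = lam) (hFμ : arensFDot CK F μ = 0)
    {k : CK} (hk0 : 0 ≤ k) (hk1 : k ≤ 1) (hk : 0 < μ k) :
    ∃ g : CK, 0 ≤ g ∧ g ≤ k ∧ g ≠ 0 ∧ lam g = 0 := by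
  have hε : ∀ n : ℕ, 0 < μ k / 2 ^ (n + 2) := fun n => by positivity
  choose c hc0 hc1 hclam hcμ using fun n =>
    exists_apply_add_apply_le hlam hμ hFlam hFμ (hε n)
  let b : ℕ → CK := fun n => (1 - c n) * k
  have hb0 : ∀ n, 0 ≤ b n := fun n t =>
    mul_nonneg (sub_nonneg.2 (hc1 n t)) (hk0 t)
  have hbk : ∀ n, b n ≤ k := fun n t => by
    have h1 : (0 : ℝ) ≤ c n t := hc0 n t
    have h2 : (0 : ℝ) ≤ k t := hk0 t
    change (1 - c n t) * k t ≤ k t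
    nlinarith
  have hblam : ∀ n, lam (b n) ≤ μ k / 2 ^ (n + 2) := fun n => by
    refine (hlam.mono fun t => ?_).trans (hclam n)
    have h1 : c n t ≤ 1 := hc1 n t
    have h2 : k t ≤ 1 := hk1 t
    change (1 - c n t) * k t ≤ 1 - c n t
    nlinarith
  have hbμ : ∀ n, μ (k - b n) ≤ μ k / 2 ^ (n + 2) := fun n => by
    refine (hμ.mono fun t => ?_).trans (hcμ n)
    have h1 : (0 : ℝ) ≤ c n t := hc0 n t
    have h2 : k t ≤ 1 := hk1 t
    change k t - (1 - c n t) * k t ≤ c n t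
    nlinarith
  let g : ℕ → CK := fun n => Nat.rec (b 0) (fun n gn => gn ⊓ b (n + 1)) n
  have hgs : ∀ n, g (n + 1) = g n ⊓ b (n + 1) := fun _ => rfl
  have hg : ∀ n, 0 ≤ g n ∧ g n ≤ k ∧ g n ≤ b n ∧
      μ (k - g n) ≤ μ k / 2 - μ k / 2 ^ (n + 2) := by
    intro n
    induction n with
    | zero =>
      refine ⟨hb0 0, hbk 0, le_rfl, (hbμ 0).trans (le_of_eq ?_)⟩
      ring
    | succ n ih =>
      obtain ⟨h0, h1, -, h2⟩ := ih
      rw [hgs]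
      refine ⟨le_inf h0 (hb0 _), inf_le_left.trans h1, inf_le_right, ?_⟩
      have h3 : k - g n ⊓ b (n + 1) ≤ (k - g n) + (k - b (n + 1)) := fun t => by
        have h4 : g n t ≤ k t := h1 t
        have h5 : b (n + 1) t ≤ k t := hbk (n + 1) t
        change k t - min (g n t) (b (n + 1) t) ≤ (k t - g n t) + (k t - b (n + 1) t)
        rcases min_choice (g n t) (b (n + 1) t) with h | h <;> rw [h] <;> linarith
      have h4 := hμ.mono h3
      rw [map_add] at h4
      have h5 := hbμ (n + 1)
      have h6 : μ k / 2 ^ (n + 2) = 2 * (μ k / 2 ^ (n + 1 + 2)) := by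
        field_simp
        ring
      linarith
  have hanti : Antitone g := antitone_nat_of_succ_le fun n => by
    rw [hgs]
    exact inf_le_left
  have hgμ : ∀ n, μ k / 2 ≤ μ (g n) := fun n => by
    have h1 := (hg n).2.2.2
    have h2 := hε n
    rw [map_sub] at h1
    linarith
  by_cases hglb : IsGLB (Set.range g) 0
  · obtain ⟨_, ⟨n, rfl⟩, hn⟩ := hoc (Set.range g) (Set.range_nonempty g)
      (by
        rintro _ ⟨i, rfl⟩ _ ⟨j, rfl⟩
        exact ⟨g (max i j), ⟨_, rfl⟩, hanti (le_max_left _ _), hanti (le_max_right _ _)⟩)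
      hglb (μ k / 2) (half_pos hk)
    have h1 := hn _ ⟨n, rfl⟩ le_rfl
    have h2 := hgμ n
    exact absurd (le_abs_self (μ (g n))) (by linarith)
  · have h0 : (0 : CK) ∈ lowerBounds (Set.range g) := by
      rintro _ ⟨n, rfl⟩
      exact (hg n).1
    obtain ⟨l, hl, hl0⟩ : ∃ l ∈ lowerBounds (Set.range g), ¬ l ≤ 0 := by
      by_contra! H
      exact hglb ⟨h0, H⟩
    have hle : ∀ n, l ⊔ 0 ≤ g n := fun n => sup_le (hl ⟨n, rfl⟩) (hg n).1
    refine ⟨l ⊔ 0, le_sup_right, (hle 0).trans (hg 0).2.1, fun h => hl0 ?_, ?_⟩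
    · rw [← h]
      exact le_sup_left
    · refine le_antisymm (ge_of_tendsto' (x := Filter.atTop)
        (f := fun n : ℕ => μ k / 4 * (1 / 2) ^ n) ?_ fun n => ?_) (hlam _ le_sup_right)
      · simpa using (tendsto_pow_atTop_nhds_zero_of_lt_one (r := (1 / 2 : ℝ))
          (by norm_num) (by norm_num)).const_mul (μ k / 4)
      · refine ((hlam.mono ((hle n).trans (hg n).2.2.1)).trans (hblam n)).trans (le_of_eq ?_)
        rw [one_div, inv_pow, pow_add]
        field_simp
        norm_num

/-- A positive order continuous functional fixed by `F` vanishes if `F` annihilates enough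
positive order continuous functionals. -/
theorem apply_one_eq_zero_of_annihilates {F : (CK →L[ℝ] ℝ) →L[ℝ] ℝ} {lam : CK →L[ℝ] ℝ}
    (hlam : dualNonneg lam) (hoc : IsOrderContinuousFun lam)
    (hFlam : arensFDot CK F lam = lam)
    (hsep : ∀ k : CK, 0 ≤ k → k ≠ 0 → ∃ μ : CK →L[ℝ] ℝ, dualNonneg μ ∧
      IsOrderContinuousFun μ ∧ arensFDot CK F μ = 0 ∧ 0 < μ k) : lam 1 = 0 := by
  let s : Set CK := {u | 0 ≤ u ∧ u ≤ 1 ∧ lam (1 - u) = 0}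
  have hne : s.Nonempty := ⟨1, fun _ => zero_le_one, le_rfl, by rw [sub_self, map_zero]⟩
  have hs1 : ∀ u ∈ s, lam u = lam 1 := fun u hu => by
    have := hu.2.2
    rw [map_sub] at this
    linarith
  by_cases hglb : IsGLB s 0
  · have hdir : DirectedOn (· ≥ ·) s := by
      intro u hu v hv
      refine ⟨u ⊓ v, ⟨le_inf hu.1 hv.1, inf_le_left.trans hu.2.1, ?_⟩,
        inf_le_left, inf_le_right⟩
      have h1 : 1 - u ⊓ v ≤ (1 - u) + (1 - v) := fun t => by
        have h2 : u t ≤ 1 := hu.2.1 t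
        have h3 : v t ≤ 1 := hv.2.1 t
        change 1 - min (u t) (v t) ≤ (1 - u t) + (1 - v t)
        rcases min_choice (u t) (v t) with h | h <;> rw [h] <;> linarith
      have h4 := hlam.mono h1
      rw [map_add, hu.2.2, hv.2.2, add_zero] at h4
      exact le_antisymm h4 (hlam _ (sub_nonneg.2 (inf_le_left.trans hu.2.1)))
    refine le_antisymm (le_of_forall_pos_lt_add fun ε hε => ?_)
      (hlam _ fun _ => zero_le_one)
    obtain ⟨u, hu, hu'⟩ := hoc s hne hdir hglb ε hε
    have := (abs_lt.1 (hu' u hu le_rfl)).2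
    rw [hs1 u hu] at this
    linarith
  · obtain ⟨l, hl, hl0⟩ : ∃ l ∈ lowerBounds s, ¬ l ≤ 0 := by
      by_contra! H
      exact hglb ⟨fun u hu => hu.1, H⟩
    have hle : ∀ u ∈ s, l ⊔ 0 ≤ u := fun u hu => sup_le (hl hu) hu.1
    have hk1 : l ⊔ 0 ≤ 1 := hle 1 ⟨fun _ => zero_le_one, le_rfl, by rw [sub_self, map_zero]⟩
    obtain ⟨μ, hμ, hμoc, hFμ, hμk⟩ := hsep (l ⊔ 0) le_sup_right fun h => hl0 (by
      rw [← h]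
      exact le_sup_left)
    obtain ⟨g, hg0, hgk, hgne, hglam⟩ :=
      exists_pos_le_apply_eq_zero hlam hμ hμoc hFlam hFμ le_sup_right hk1 hμk
    have hmul : ∀ n : ℕ, n • g ≤ 1 := by
      intro n
      induction n with
      | zero =>
        rw [zero_smul]
        exact fun _ => zero_le_one
      | succ n ih =>
        have h1 : 1 - n • g ∈ s := by
          refine ⟨sub_nonneg.2 ih, sub_le_self _ (nsmul_nonneg hg0 n), ?_⟩
          rw [sub_sub_cancel, map_nsmul, hglam, smul_zero]
        have h2 := hgk.trans (hle _ h1)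
        rw [succ_nsmul']
        exact le_sub_iff_add_le.1 h2
    refine absurd (ContinuousMap.ext fun t => ?_) hgne
    by_contra ht
    have ht0 : 0 < g t := lt_of_le_of_ne (hg0 t) (Ne.symm ht)
    obtain ⟨n, hn⟩ := Archimedean.arch 2 ht0
    have h3 : n • g t ≤ 1 := hmul n t
    linarith

theorem abs_apply_le_dualAbs (ρ : CK →L[ℝ] ℝ) {b : CK} (hb : 0 ≤ b) : |ρ b| ≤ dualAbs ρ b := by
  have hbdd : BddAbove ((fun c => ρ c) '' {c : CK | |c| ≤ b}) := by
    refine ⟨‖ρ‖ * ‖b‖, ?_⟩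
    rintro _ ⟨c, hc, rfl⟩
    refine (le_abs_self _).trans ((ρ.le_opNorm c).trans
      (mul_le_mul_of_nonneg_left ?_ (norm_nonneg _)))
    refine (ContinuousMap.norm_le _ (norm_nonneg _)).2 fun t => ?_
    have h1 : |c t| ≤ b t := hc t
    exact h1.trans ((le_abs_self _).trans (b.norm_coe_le_norm t))
  refine abs_le'.2 ⟨le_csSup hbdd ⟨b, ?_, rfl⟩, le_csSup hbdd ⟨-b, ?_, map_neg ρ b⟩⟩
  · exact (abs_of_nonneg hb).le
  · exact (abs_neg b).le.trans (abs_of_nonneg hb).le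

theorem eq_zero_of_dualDisjoint_self {ρ : CK →L[ℝ] ℝ} (h : DualDisjoint ρ ρ) : ρ = 0 := by
  have hpos : ∀ a : CK, 0 ≤ a → ρ a = 0 := fun a ha => by
    refine abs_nonpos_iff.1 (le_of_forall_pos_lt_add fun ε hε => ?_)
    obtain ⟨b, c, hb, hc, rfl, hbc⟩ := h a ha ε hε
    rw [map_add, zero_add]
    exact (abs_add_le _ _).trans_lt ((add_le_add (abs_apply_le_dualAbs ρ hb)
      (abs_apply_le_dualAbs ρ hc)).trans_lt hbc)
  ext a
  rw [← posPart_sub_negPart a, map_sub, hpos _ (posPart_nonneg a), hpos _ (negPart_nonneg a),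
    sub_self]
  rfl

end Disjointness

namespace IsCenterRep

variable {E D K : Type*}
  [Lattice E] [AddCommGroup E] [IsOrderedAddMonoid E] [Module ℝ E] [PosSMulMono ℝ E]
  [Lattice D] [AddCommGroup D] [IsOrderedAddMonoid D] [Module ℝ D] [PosSMulMono ℝ D]
  [TopologicalSpace K] [CompactSpace K] {pE : D → E → ℝ} {Θ : C(K, ℝ) → D → D}

/-- The orbit functional `h ↦ φ (Θ h f)` of an order bounded functional is continuous. -/
theorem exists_orbitFunctional (hΘ : IsCenterRep Θ) {φ : D → ℝ} (hφ : IsLinearMap ℝ φ)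
    (hb : IsOrdBdd φ) (f : D) : ∃ μ : C(K, ℝ) →L[ℝ] ℝ, ∀ h, μ h = φ (Θ h f) := by
  have hbound : ∀ f : D, 0 ≤ f → ∃ M : ℝ, ∀ h : C(K, ℝ), |φ (Θ h f)| ≤ M * ‖h‖ := by
    intro f hf
    obtain ⟨c, d, hcd⟩ := hb (-f) f
    have h1 : ∀ h : C(K, ℝ), ‖h‖ ≤ 1 → |φ (Θ h f)| ≤ max |c| |d| := fun h hh => by
      have h2 : ∀ t, |h t| ≤ 1 := fun t => (h.norm_coe_le_norm t).trans hh
      have h3 : Θ h f ≤ f := hΘ.le_self (fun t => (abs_le.1 (h2 t)).2) hf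
      have h4 : Θ (-h) f ≤ f := hΘ.le_self (fun t => neg_le.1 (abs_le.1 (h2 t)).1) hf
      have h5 : Θ (-h) f = -Θ h f := by
        rw [← zero_sub h, hΘ.map_sub, hΘ.map_zero, zero_sub, Pi.neg_apply]
      rw [h5] at h4
      obtain ⟨h6, h7⟩ := hcd _ (neg_le.1 h4) h3
      exact abs_le_max_abs_abs h6 h7
    refine ⟨max |c| |d|, fun h => ?_⟩
    rcases eq_or_ne h 0 with rfl | hne
    · rw [hΘ.map_zero, Pi.zero_apply, hφ.map_zero, abs_zero, norm_zero, mul_zero]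
    · have hn : 0 < ‖h‖ := norm_pos_iff.2 hne
      have h2 := h1 (‖h‖⁻¹ • h) (by
        rw [norm_smul, norm_inv, norm_norm, inv_mul_cancel₀ hn.ne'])
      rw [hΘ.map_smul, Pi.smul_apply, hφ.map_smul, smul_eq_mul, abs_mul,
        abs_of_pos (inv_pos.2 hn), inv_mul_le_iff₀ hn] at h2
      linarith
  obtain ⟨M, hM⟩ := hbound _ (posPart_nonneg f)
  obtain ⟨M', hM'⟩ := hbound _ (negPart_nonneg f)
  let L : C(K, ℝ) →ₗ[ℝ] ℝ :=
    { toFun := fun h => φ (Θ h f)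
      map_add' := fun h h' => by rw [hΘ.map_add, Pi.add_apply, hφ.map_add]
      map_smul' := fun c h => by
        rw [hΘ.map_smul, Pi.smul_apply, hφ.map_smul, RingHom.id_apply] }
  refine ⟨L.mkContinuous (M + M') fun h => ?_, fun h => rfl⟩
  change |φ (Θ h f)| ≤ _
  have h1 : φ (Θ h f) = φ (Θ h f⁺) - φ (Θ h f⁻) := by
    rw [← hφ.map_sub, ← (hΘ.isLinearMap h).map_sub, posPart_sub_negPart]
  rw [h1, add_mul]
  exact (abs_sub _ _).trans (add_le_add (hM h) (hM' h))

theorem arensDotL_orbitFunctional (hΘ : IsCenterRep Θ) {φ : D → ℝ} {f : D}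
    {μ : C(K, ℝ) →L[ℝ] ℝ} (hμ : ∀ h, μ h = φ (Θ h f)) (a h : C(K, ℝ)) :
    arensDotL C(K, ℝ) μ a h = φ (Θ h (Θ a f)) := by
  rw [arensDotL_apply, hμ, mul_comm, hΘ.map_mul]

theorem exists_apply_pos (hΘ : IsCenterRep Θ) (hD : IsOrderDual E D pE) {k : C(K, ℝ)}
    (hk : 0 ≤ k) (hk' : k ≠ 0) : ∃ f : D, ∃ x : E, 0 ≤ f ∧ 0 ≤ x ∧ 0 < pE (Θ k f) x := by
  by_contra! H
  refine hk' (hΘ.eq_of_forall_nonneg fun f hf => ?_)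
  rw [hΘ.map_zero]
  refine le_antisymm ((hD.le_iff _ _).2 fun x hx => ?_) (hΘ.nonneg hk hf)
  rw [Pi.zero_apply, hD.map_zero]
  exact H f x hf hx

end IsCenterRep

theorem IsOrderDual.isOrdBdd_eval {E D : Type*}
    [Lattice E] [AddCommGroup E] [Module ℝ E]
    [Lattice D] [AddCommGroup D] [Module ℝ D]
    {pE : D → E → ℝ} (hD : IsOrderDual E D pE) {x : E} (hx : 0 ≤ x) :
    IsOrdBdd fun f => pE f x := fun a b =>
  ⟨pE a x, pE b x, fun f hf hf' => ⟨(hD.le_iff a f).1 hf x hx, (hD.le_iff f b).1 hf' x hx⟩⟩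

theorem isOrderedAddMonoid_of_covariantClass {X : Type*} [Lattice X] [AddCommGroup X]
    [CovariantClass X X (· + ·) (· ≤ ·)] : IsOrderedAddMonoid X := by
  have key : ∀ a b c : X, a ≤ b → c + a ≤ c + b := fun _ _ c h => CovariantClass.elim c h
  exact ⟨fun a b h c => by simpa only [add_comm] using key a b c h, fun a b h c => key a b c h⟩

/-- Corollary 6(3).  Same setting as Corollary 6(2): `E` a Riesz space
with point separating order dual, `Z(E^∼) = C(K)` with `K` hyperstonian, `π ∈ C(K)''`
the idempotent with `Z(E^{∼∼}) = π⬝C(K)''` and `Ker(m) = (1-π)⬝C(K)''`, and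
`p ∈ C(K)''` the band projection of `C(K)'` onto the band `C(K)ₙ' = C(K)_*` of order
continuous functionals.  Then `p ≤ π`, and the action of `p` on the order bidual
satisfies `p∘E^{∼∼} = (E^∼)ₙ^∼`: `p∘x''` is always order continuous, and `p∘x'' = x''`
exactly when `x''` is order continuous. -/
theorem statement17
    {E D DD K : Type*}
    [Lattice E] [AddCommGroup E] [Module ℝ E]
    [CovariantClass E E (· + ·) (· ≤ ·)] [PosSMulMono ℝ E]
    [Lattice D] [AddCommGroup D] [Module ℝ D]
    [CovariantClass D D (· + ·) (· ≤ ·)] [PosSMulMono ℝ D]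
    [Lattice DD] [AddCommGroup DD] [Module ℝ DD]
    [CovariantClass DD DD (· + ·) (· ≤ ·)] [PosSMulMono ℝ DD]
    [TopologicalSpace K] [CompactSpace K] [T2Space K]
    (pE : D → E → ℝ) (hD : IsOrderDual E D pE) (hsep : SepPoints pE)
    (pD : DD → D → ℝ) (hDD : IsOrderDual D DD pD)
    -- `K` is hyperstonian:
    (hStonian : ExtremallyDisconnected K)
    (hKsep : ∀ h : C(K, ℝ), h ≠ 0 → ∃ φ : C(K, ℝ) → ℝ,
      IsLinearMap ℝ φ ∧ IsOrdBdd φ ∧ IsOrderContinuousFun φ ∧ φ h ≠ 0)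
    -- `Θ` realizes `Z(E^∼) = C(K)`:
    (Θ : C(K, ℝ) → D → D)
    (hΘadd : ∀ h h' : C(K, ℝ), Θ (h + h') = Θ h + Θ h')
    (hΘsmul : ∀ (c : ℝ) (h : C(K, ℝ)), Θ (c • h) = c • Θ h)
    (hΘmul : ∀ (h h' : C(K, ℝ)) (f : D), Θ (h * h') f = Θ h (Θ h' f))
    (hΘone : ∀ f : D, Θ 1 f = f)
    (hΘinj : Function.Injective Θ)
    (hΘcentral : ∀ h : C(K, ℝ), IsCentral (Θ h))
    (hΘsurj : ∀ S : D → D, IsCentral S → ∃ h : C(K, ℝ), Θ h = S)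
    (hΘlat : ∀ (h h' : C(K, ℝ)) (f : D), 0 ≤ f → Θ (h ⊔ h') f = Θ h f ⊔ Θ h' f)
    (hΘnorm : ∀ h : C(K, ℝ), ‖h‖ =
      sInf {c : ℝ | 0 ≤ c ∧ ∀ f : D, 0 ≤ f → -(c • f) ≤ Θ h f ∧ Θ h f ≤ c • f})
    -- the Arens homomorphism `m : C(K)'' → Z(E^{∼∼})`:
    (m : ((C(K, ℝ) →L[ℝ] ℝ) →L[ℝ] ℝ) → DD → DD)
    (hm : ∀ (F : (C(K, ℝ) →L[ℝ] ℝ) →L[ℝ] ℝ) (x'' : DD) (f : D) (μ : C(K, ℝ) →L[ℝ] ℝ),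
      (∀ h : C(K, ℝ), μ h = pD x'' (Θ h f)) → pD (m F x'') f = F μ)
    -- `π` is the idempotent with `Z(E^{∼∼}) = π⬝C(K)''` and `Ker(m) = (1-π)⬝C(K)''`:
    (π : (C(K, ℝ) →L[ℝ] ℝ) →L[ℝ] ℝ)
    (hπidem : arensMul C(K, ℝ) π π = π)
    (hπrange : {S : DD → DD | IsCentral S} =
      Set.range (fun F => m (arensMul C(K, ℝ) π F)))
    (hπker : {F : (C(K, ℝ) →L[ℝ] ℝ) →L[ℝ] ℝ | ∀ x'' : DD, m F x'' = 0} =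
      Set.range (fun F => arensMul C(K, ℝ) (arensOne C(K, ℝ) - π) F))
    -- `p` is the band projection of `C(K)'` onto the band of order continuous
    -- functionals: `p⬝μ` is always order continuous and `μ - p⬝μ` is disjoint from
    -- every order continuous functional:
    (p : (C(K, ℝ) →L[ℝ] ℝ) →L[ℝ] ℝ)
    (hpidem : arensMul C(K, ℝ) p p = p)
    (hpproj : ∀ μ : C(K, ℝ) →L[ℝ] ℝ,
      IsOrderContinuousFun ⇑(arensFDot C(K, ℝ) p μ) ∧
      ∀ ν : C(K, ℝ) →L[ℝ] ℝ, IsOrderContinuousFun ⇑ν →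
        DualDisjoint (μ - arensFDot C(K, ℝ) p μ) ν) :
    -- `p ≤ π` in `C(K)''`:
    bidualLe p π ∧
    -- `p ∘ E^{∼∼} = (E^∼)ₙ^∼`: whenever `y'' = p∘x''` (characterized by
    -- `y''(f) = p(μ_{f,x''})`), `y''` is order continuous, and `y'' = x''` iff `x''`
    -- is order continuous:
    (∀ x'' y'' : DD,
      (∀ (f : D) (μ : C(K, ℝ) →L[ℝ] ℝ),
        (∀ h : C(K, ℝ), μ h = pD x'' (Θ h f)) → pD y'' f = p μ) →
      (IsOrderContinuousFun (pD y'') ∧ (y'' = x'' ↔ IsOrderContinuousFun (pD x'')))) := by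
  have : IsOrderedAddMonoid E := isOrderedAddMonoid_of_covariantClass
  have : IsOrderedAddMonoid D := isOrderedAddMonoid_of_covariantClass
  have : IsOrderedAddMonoid DD := isOrderedAddMonoid_of_covariantClass
  have hΘ : IsCenterRep Θ :=
    ⟨hΘadd, hΘsmul, hΘmul, hΘone, hΘinj, hΘcentral, hΘsurj, hΘlat⟩
  have hπ : ∀ μ, π (arensFDot C(K, ℝ) π μ) = π μ := fun μ => DFunLike.congr_fun hπidem μ
  have hp : ∀ μ, p (arensFDot C(K, ℝ) p μ) = p μ := fun μ => DFunLike.congr_fun hpidem μ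
  have hσ := idem_one_sub hπ
  have hq := idem_one_sub hp
  set σ := arensOne C(K, ℝ) - π with hσdef
  have hone : ∀ μ : C(K, ℝ) →L[ℝ] ℝ, arensOne C(K, ℝ) μ = μ 1 := fun _ => rfl
  have hσm : ∀ x'' : DD, m σ x'' = 0 := by
    have h1 : σ ∈ {F : (C(K, ℝ) →L[ℝ] ℝ) →L[ℝ] ℝ | ∀ x'' : DD, m F x'' = 0} := by
      rw [hπker]
      refine ⟨arensOne C(K, ℝ), ?_⟩
      ext μ
      rw [arensMul_apply, arensFDot_arensOne]
    exact h1
  have hσorbit : ∀ (x'' : DD) (f : D) (μ : C(K, ℝ) →L[ℝ] ℝ),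
      (∀ h, μ h = pD x'' (Θ h f)) → arensFDot C(K, ℝ) σ μ = 0 := by
    intro x'' f μ hμ
    ext a
    rw [arensFDot_apply, ← hm σ x'' (Θ a f) _ (hΘ.arensDotL_orbitFunctional hμ a), hσm,
      hDD.map_zero]
    rfl
  have hsep' : ∀ k : C(K, ℝ), 0 ≤ k → k ≠ 0 → ∃ μ : C(K, ℝ) →L[ℝ] ℝ, dualNonneg μ ∧
      IsOrderContinuousFun μ ∧ arensFDot C(K, ℝ) σ μ = 0 ∧ 0 < μ k := by
    intro k hk hk'
    obtain ⟨f, x, hf, hx, hpos⟩ := hΘ.exists_apply_pos hD hk hk'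
    obtain ⟨x'', hx''⟩ := hDD.surj _ (hD.lin_vec x) (hD.isOrdBdd_eval hx)
    obtain ⟨μ, hμ⟩ := hΘ.exists_orbitFunctional (hD.lin_vec x) (hD.isOrdBdd_eval hx) f
    refine ⟨μ, fun a ha => ?_, ?_, hσorbit x'' f μ fun h => ?_, ?_⟩
    · rw [hμ]
      exact hD.nonneg (hΘ.nonneg ha hf) hx
    · rw [show (μ : C(K, ℝ) → ℝ) = _ from funext hμ]
      exact hΘ.isOrderContinuousFun_comp hD (hD.lin_vec x) (hD.isOrderContinuousFun_eval hx) f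
    · rw [hμ, hx'']
    · rw [hμ]
      exact hpos
  have hσzero : ∀ ν : C(K, ℝ) →L[ℝ] ℝ, dualNonneg ν → IsOrderContinuousFun ν → σ ν = 0 := by
    intro ν hν hνoc
    rw [← arensFDot_one]
    have hlam := dualNonneg_arensFDot_of_idem hσ hν
    refine apply_one_eq_zero_of_annihilates hlam ?_ ?_ hsep'
    · refine hνoc.of_nonneg_of_le hlam fun a ha => ?_
      have h1 := dualNonneg_arensFDot_of_idem hπ hν a ha
      rw [hσdef, arensFDot_sub_left, arensFDot_arensOne, sub_apply]
      linarith
    · ext a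
      rw [arensFDot_apply, arensDotL_arensFDot, hσ, arensFDot_apply]
  refine ⟨fun μ hμ => ?_, fun x'' y'' hy => ?_⟩
  · have hν := dualNonneg_arensFDot_of_idem hp hμ
    have h1 := hσzero _ hν (hpproj μ).1
    have h2 := arensFDot_apply_nonneg_of_idem hπ (dualNonneg_arensFDot_of_idem hq hμ)
    rw [arensFDot_sub_left, arensFDot_arensOne, map_sub] at h2
    rw [hσdef, sub_apply, hone, arensFDot_one] at h1
    linarith
  · have hy' : ∀ (f : D) (μ : C(K, ℝ) →L[ℝ] ℝ), (∀ h, μ h = pD x'' (Θ h f)) →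
        ∀ h, pD y'' (Θ h f) = arensFDot C(K, ℝ) p μ h := fun f μ hμ h =>
      hy (Θ h f) _ (hΘ.arensDotL_orbitFunctional hμ h)
    have hyoc : IsOrderContinuousFun (pD y'') := by
      refine hΘ.isOrderContinuousFun_of_comp hD fun f => ?_
      obtain ⟨μ, hμ⟩ := hΘ.exists_orbitFunctional (hDD.lin_fun x'') (hDD.bdd x'') f
      rw [funext (hy' f μ hμ)]
      exact (hpproj μ).1
    refine ⟨hyoc, fun h => h ▸ hyoc, fun hx => hDD.inj _ _ fun f => ?_⟩
    obtain ⟨μ, hμ⟩ := hΘ.exists_orbitFunctional (hDD.lin_fun x'') (hDD.bdd x'') f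
    have hμoc : IsOrderContinuousFun μ := by
      rw [show (μ : C(K, ℝ) → ℝ) = _ from funext hμ]
      exact hΘ.isOrderContinuousFun_comp hD (hDD.lin_fun x'') hx f
    have h0 := eq_zero_of_dualDisjoint_self
      ((hpproj μ).2 (μ - arensFDot C(K, ℝ) p μ) (hμoc.sub (hpproj μ).1))
    rw [sub_eq_zero] at h0
    rw [← hΘone f, hy' f μ hμ 1, ← h0, hμ]
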